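/- Let f ∈ ℬ with upper semicontinuous envelope f*(x) = limsup_{y→x} f(y). Then with probability one the following holds simultaneously for all x, y ∈ [0,∞)^d: limsup_{n→∞} n^{-1/d} (U_n(x) − U_n(y)) ≤ c_d · d · M^{(d−1)/d} · (sup_{[0,M]^d} f*)^{1/d} · |x − y|^{1/d}, where M = max{x_1, y_1, x_2, y_2, …, x_d, y_d}. -/

import Mathlib

open MeasureTheory Filter Set Topology

noncomputable section

/-- `ℓ(A)`: the maximal cardinality of a chain (finite subset totally ordered by the
coordinatewise partial order `≤`) contained in `A ⊆ ℝ^d`. -/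
def chainLength (d : ℕ) (A : Set (Fin d → ℝ)) : ℕ :=
  sSup {n : ℕ | ∃ C : Finset (Fin d → ℝ),
    ↑C ⊆ A ∧ IsChain (· ≤ ·) (C : Set (Fin d → ℝ)) ∧ C.card = n}

/-- The class `ℬ` of nonnegative, locally bounded, Lebesgue-measurable functions. -/
def MemB (d : ℕ) (f : (Fin d → ℝ) → ℝ) : Prop :=
  Measurable f ∧ (∀ x, 0 ≤ f x) ∧ ∀ x : Fin d → ℝ, ∃ U ∈ 𝓝 x, BddAbove (f '' U)

/-- The Euclidean norm on `ℝ^d` (modelled as `Fin d → ℝ`). -/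
def euclNorm (d : ℕ) (x : Fin d → ℝ) : ℝ := Real.sqrt (∑ i, (x i) ^ 2)

/-- The expectation `E[ℓ_n]` of the length of a longest chain among `n` i.i.d. points
uniformly distributed in the unit cube `[0,1]^d`. -/
def BWexpect (d n : ℕ) : ℝ :=
  ∫ X : Fin n → Fin d → ℝ, (chainLength d (Set.range X) : ℝ)
    ∂(Measure.pi fun _ => volume.restrict (Set.Icc (0 : Fin d → ℝ) 1))

/-- `c` is the Bollobás–Winkler constant `c_d`: `c > 0` and `n^{-1/d} E[ℓ_n] → c`. -/
def IsBWConstant (d : ℕ) (c : ℝ) : Prop :=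
  0 < c ∧ Tendsto (fun n : ℕ => (n : ℝ) ^ (-(1 : ℝ) / d) * BWexpect d n) atTop (nhds c)

/-- A Poisson point process on `ℝ^d` with intensity function `g`, on a probability space
`(Ω, P)`: a random at-most-countable subset of `ℝ^d` such that for every bounded Borel set `A`
the count `#(pts ω ∩ A)` is measurable with Poisson distribution of mean `∫_A g`, and counts of
pairwise disjoint Borel sets are independent. -/
structure PoissonPP (d : ℕ) {Ω : Type*} [MeasurableSpace Ω] (P : Measure Ω)
    (g : (Fin d → ℝ) → ℝ) where
  pts : Ω → Set (Fin d → ℝ)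
  countable : ∀ ω, (pts ω).Countable
  measur : ∀ A : Set (Fin d → ℝ), MeasurableSet A → Bornology.IsBounded A →
    ∀ k : ℕ, MeasurableSet {ω | (pts ω ∩ A).encard = k}
  poisson : ∀ A : Set (Fin d → ℝ), MeasurableSet A → Bornology.IsBounded A →
    ∀ k : ℕ, P {ω | (pts ω ∩ A).encard = k}
      = ENNReal.ofReal (Real.exp (-(∫ x in A, g x)) * (∫ x in A, g x) ^ k / k.factorial)
  indep : ∀ (n : ℕ) (A : Fin n → Set (Fin d → ℝ)),
    (∀ i, MeasurableSet (A i)) → (∀ i, Bornology.IsBounded (A i)) →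
    (Pairwise fun i j => Disjoint (A i) (A j)) →
    ∀ k : Fin n → ℕ,
      P (⋂ i, {ω | (pts ω ∩ A i).encard = k i})
        = ∏ i, P {ω | (pts ω ∩ A i).encard = k i}

/-- Upper semicontinuous envelope `f*`. -/
def upperEnv (d : ℕ) (f : (Fin d → ℝ) → ℝ) (x : Fin d → ℝ) : ℝ := limsup f (𝓝 x)

/-- Lower semicontinuous envelope `f_*`. -/
def lowerEnv (d : ℕ) (f : (Fin d → ℝ) → ℝ) (x : Fin d → ℝ) : ℝ := liminf f (𝓝 x)

/-- The simplex `S_{x,v} = {z : z ≤ x, ⟨x-z,v⟩ ≤ 1}`. -/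
def simplexS (d : ℕ) (x v : Fin d → ℝ) : Set (Fin d → ℝ) :=
  {z | z ≤ x ∧ ∑ i, (x i - z i) * v i ≤ 1}

/-- `u` is a nondecreasing viscosity solution of the problem (P):
`u_{x_1} ⋯ u_{x_d} = (c_d/d)^d f` in `(0,∞)^d`, `u = 0` on `∂ℝ^d_+`. -/
def IsNDViscSol (d : ℕ) (c : ℝ) (f u : (Fin d → ℝ) → ℝ) : Prop :=
  ContinuousOn u (Set.Ici 0) ∧
  (∀ x y : Fin d → ℝ, 0 ≤ x → x ≤ y → u x ≤ u y) ∧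
  (∀ x : Fin d → ℝ, 0 ≤ x → (∃ i, x i = 0) → u x = 0) ∧
  (∀ x₀ : Fin d → ℝ, (∀ i, 0 < x₀ i) →
    ∀ φ : (Fin d → ℝ) → ℝ, ContDiff ℝ ((⊤ : ℕ∞) : WithTop ℕ∞) φ →
      IsLocalMaxOn (fun y => u y - φ y) (Set.Ici 0) x₀ →
      ∏ i, fderiv ℝ φ x₀ (Pi.single i 1) ≤ (c / d) ^ d * upperEnv d f x₀) ∧
  (∀ x₀ : Fin d → ℝ, (∀ i, 0 < x₀ i) →
    ∀ φ : (Fin d → ℝ) → ℝ, ContDiff ℝ ((⊤ : ℕ∞) : WithTop ℕ∞) φ →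
      IsLocalMinOn (fun y => u y - φ y) (Set.Ici 0) x₀ →
      (c / d) ^ d * lowerEnv d f x₀ ≤ ∏ i, fderiv ℝ φ x₀ (Pi.single i 1))


/-- A bounded measurable function is integrable for a finite measure. -/
lemma integrable_of_abs_le {β : Type*} [MeasurableSpace β] {μ : Measure β} [IsFiniteMeasure μ]
    {u : β → ℝ} {K : ℝ} (hu : Measurable u) (hK : ∀ x, |u x| ≤ K) : Integrable u μ :=
  Integrable.of_bound hu.aestronglyMeasurable K (Eventually.of_forall hK)

/-- The second moment exceeds the squared mean by at most the mean squared distance to any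
constant. -/
lemma integral_sq_le_sq_add {β : Type*} [MeasurableSpace β] {μ : Measure β}
    [IsProbabilityMeasure μ] {u : β → ℝ} {K : ℝ} (hu : Measurable u) (hK : ∀ x, |u x| ≤ K)
    (k : ℝ) : ∫ x, u x ^ 2 ∂μ ≤ (∫ x, u x ∂μ) ^ 2 + ∫ x, (u x - k) ^ 2 ∂μ := by
  have h1 : Integrable u μ := integrable_of_abs_le hu hK
  have h2 : Integrable (fun x => u x ^ 2) μ :=
    integrable_of_abs_le (hu.pow_const 2) (K := K ^ 2) fun x => by
      rw [abs_pow]; exact pow_le_pow_left₀ (abs_nonneg _) (hK x) 2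
  have h3 : ∫ x, (u x - k) ^ 2 ∂μ = ∫ x, u x ^ 2 ∂μ - 2 * k * ∫ x, u x ∂μ + k ^ 2 := by
    have : (fun x => (u x - k) ^ 2) = fun x => (u x ^ 2 - 2 * k * u x) + k ^ 2 := by
      ext x; ring
    have h4 : Integrable (fun x => 2 * k * u x) μ := h1.const_mul _
    have h5 : Integrable (fun x => u x ^ 2 - 2 * k * u x) μ := h2.sub h4
    rw [this, integral_add h5 (integrable_const _), integral_sub h2 h4, integral_const_mul]
    simp
  rw [h3]
  nlinarith [sq_nonneg (∫ x, u x ∂μ - k)]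

/-- Integration over `Fin (N + 1) → α` by integrating the first coordinate last in the
product order. -/
lemma integral_pi_succ {α : Type*} [MeasurableSpace α] {μ : Measure α} [IsProbabilityMeasure μ]
    {N : ℕ} {G : (Fin (N + 1) → α) → ℝ} {K : ℝ} (hG : Measurable G) (hK : ∀ x, |G x| ≤ K) :
    ∫ x, G x ∂(Measure.pi fun _ => μ) =
      ∫ y, ∫ a, G (Fin.cons a y) ∂μ ∂(Measure.pi fun _ : Fin N => μ) := by
  have hmp := (measurePreserving_piFinSuccAbove (fun _ : Fin (N + 1) => μ) 0).symm
  rw [← hmp.integral_comp']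
  have hmeas : Measurable fun p : α × (Fin N → α) =>
      G ((MeasurableEquiv.piFinSuccAbove (fun _ => α) 0).symm p) :=
    hG.comp (MeasurableEquiv.measurable _)
  rw [integral_prod_symm _ (integrable_of_abs_le hmeas fun p => hK _)]
  simp [MeasurableEquiv.piFinSuccAbove_symm_apply, Fin.consEquiv]

lemma measurable_finCons {α : Type*} [MeasurableSpace α] {N : ℕ} :
    Measurable fun p : (Fin N → α) × α => (Fin.cons p.2 p.1 : Fin (N + 1) → α) := by
  refine measurable_pi_lambda _ fun i => ?_
  refine Fin.cases ?_ (fun j => ?_) i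
  · simpa using measurable_snd
  · simp only [Fin.cons_succ]
    exact (measurable_pi_apply j).comp measurable_fst

/-- The Efron–Stein inequality. -/
theorem efron_stein {α : Type*} [MeasurableSpace α] (μ : Measure α) [IsProbabilityMeasure μ]
    (N : ℕ) (g : (Fin N → α) → ℝ) (h : Fin N → (Fin N → α) → ℝ) (K : ℝ)
    (hg : Measurable g) (hgK : ∀ x, |g x| ≤ K)
    (hh : ∀ i, Measurable (h i)) (hhK : ∀ i x, |h i x| ≤ K)
    (hupd : ∀ i x a, h i (Function.update x i a) = h i x) :
    ∫ x, g x ^ 2 ∂(Measure.pi fun _ => μ) ≤ (∫ x, g x ∂(Measure.pi fun _ => μ)) ^ 2 +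
      ∑ i, ∫ x, (g x - h i x) ^ 2 ∂(Measure.pi fun _ => μ) := by
  induction N with
  | zero =>
    have := integral_sq_le_sq_add (μ := Measure.pi fun _ : Fin 0 => μ) hg hgK (g default)
    have h0 : ∀ x, g x = g default := fun x => by rw [Subsingleton.elim x default]
    simp [h0] 
  | succ N ih =>
    have hsq : ∀ {β : Type _} (u : β → ℝ) (C : ℝ), (∀ x, |u x| ≤ C) → ∀ x, |u x ^ 2| ≤ C ^ 2 := by
      intro β u C hu x
      rw [abs_pow]; exact pow_le_pow_left₀ (abs_nonneg _) (hu x) 2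
    have hdiff : ∀ i x, |g x - h i x| ≤ K + K := fun i x =>
      (abs_sub _ _).trans (add_le_add (hgK x) (hhK i x))
    have hgc : Measurable fun p : (Fin N → α) × α => g (Fin.cons p.2 p.1) :=
      hg.comp measurable_finCons
    have hhc : ∀ i, Measurable fun p : (Fin N → α) × α => h i (Fin.cons p.2 p.1) := fun i =>
      (hh i).comp measurable_finCons
    have hgy : ∀ y : Fin N → α, Measurable fun a => g (Fin.cons a y) := fun y =>
      hgc.comp measurable_prodMk_left
    have hhy : ∀ i (y : Fin N → α), Measurable fun a => h i (Fin.cons a y) := fun i y =>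
      (hhc i).comp measurable_prodMk_left
    have hKint : ∀ u : α → ℝ, (∀ a, |u a| ≤ K) → |∫ a, u a ∂μ| ≤ K := fun u hu => by
      have := norm_integral_le_of_norm_le_const (μ := μ) (f := u) (C := K) (Eventually.of_forall hu)
      simpa using this
    have hmint : ∀ u : (Fin N → α) × α → ℝ, Measurable u →
        Measurable fun y => ∫ a, u (y, a) ∂μ := fun u hu =>
      (hu.stronglyMeasurable.integral_prod_right' (ν := μ)).measurable
    set G : (Fin N → α) → ℝ := fun y => ∫ a, g (Fin.cons a y) ∂μ with hG
    set H : Fin N → (Fin N → α) → ℝ := fun i y => ∫ a, h i.succ (Fin.cons a y) ∂μ with hH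
    have hGm : Measurable G := hmint _ hgc
    have hHm : ∀ i, Measurable (H i) := fun i => hmint _ (hhc i.succ)
    have key := ih G H hGm (fun y => hKint _ fun a => hgK _) hHm
      (fun i y => hKint _ fun a => hhK _ _) (fun i y b => by
        simp only [hH]
        refine integral_congr_ae (Eventually.of_forall fun a => ?_)
        have := hupd i.succ (Fin.cons a y) b
        simpa [Fin.cons_update] using this)
    have e1 := integral_pi_succ (μ := μ) (G := fun x => g x ^ 2) (hg.pow_const 2) (hsq g K hgK)
    have e2 := integral_pi_succ (μ := μ) hg hgK
    have e3 : ∀ i, _ := fun i => integral_pi_succ (μ := μ) (G := fun x => (g x - h i x) ^ 2)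
      ((hg.sub (hh i)).pow_const 2) (hsq _ _ (hdiff i))
    have hdm : ∀ i, Measurable fun y : Fin N → α =>
        ∫ a, (g (Fin.cons a y) - h i (Fin.cons a y)) ^ 2 ∂μ := fun i =>
      hmint (fun p => (g (Fin.cons p.2 p.1) - h i (Fin.cons p.2 p.1)) ^ 2)
        ((hgc.sub (hhc i)).pow_const 2)
    have hdK : ∀ i (y : Fin N → α),
        |∫ a, (g (Fin.cons a y) - h i (Fin.cons a y)) ^ 2 ∂μ| ≤ (K + K) ^ 2 := fun i y => by
      have := norm_integral_le_of_norm_le_const (μ := μ)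
        (f := fun a => (g (Fin.cons a y) - h i (Fin.cons a y)) ^ 2) (C := (K + K) ^ 2)
        (Eventually.of_forall fun a => hsq _ _ (hdiff i) _)
      simpa using this
    have hdI : ∀ i, Integrable (fun y : Fin N → α =>
        ∫ a, (g (Fin.cons a y) - h i (Fin.cons a y)) ^ 2 ∂μ) (Measure.pi fun _ => μ) := fun i =>
      integrable_of_abs_le (hdm i) (hdK i)
    have hGI : Integrable (fun y => G y ^ 2) (Measure.pi fun _ : Fin N => μ) :=
      integrable_of_abs_le (hGm.pow_const 2) (hsq G K fun y => hKint _ fun a => hgK _)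
    have step0 : ∫ y, ∫ a, g (Fin.cons a y) ^ 2 ∂μ ∂(Measure.pi fun _ : Fin N => μ) ≤
        ∫ y, G y ^ 2 ∂(Measure.pi fun _ : Fin N => μ) +
          ∫ y, ∫ a, (g (Fin.cons a y) - h 0 (Fin.cons a y)) ^ 2 ∂μ
            ∂(Measure.pi fun _ : Fin N => μ) := by
      rw [← integral_add hGI (hdI 0)]
      refine integral_mono_of_nonneg (Eventually.of_forall fun y => integral_nonneg fun a =>
        sq_nonneg _) (hGI.add (hdI 0)) (Eventually.of_forall fun y => ?_)
      rcases isEmpty_or_nonempty α with hα | ⟨⟨a₀⟩⟩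
      · exact absurd (IsProbabilityMeasure.measure_univ (μ := μ)) (by simp [Set.univ_eq_empty_iff.2 hα])
      have hconst : ∀ a, h 0 (Fin.cons a y) = h 0 (Fin.cons a₀ y) := fun a => by
        have := hupd 0 (Fin.cons a₀ y) a
        rw [Fin.update_cons_zero] at this
        exact this
      have := integral_sq_le_sq_add (μ := μ) (hgy y) (fun a => hgK (Fin.cons a y))
        (h 0 (Fin.cons a₀ y))
      simpa only [hconst, hG, Pi.add_apply] using this
    have step1 : ∀ i : Fin N, ∫ y, (G y - H i y) ^ 2 ∂(Measure.pi fun _ : Fin N => μ) ≤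
        ∫ y, ∫ a, (g (Fin.cons a y) - h i.succ (Fin.cons a y)) ^ 2 ∂μ
            ∂(Measure.pi fun _ : Fin N => μ) := fun i => by
      refine integral_mono_of_nonneg (Eventually.of_forall fun y => sq_nonneg _) (hdI _)
        (Eventually.of_forall fun y => ?_)
      have hI1 : Integrable (fun a => g (Fin.cons a y)) μ :=
        integrable_of_abs_le (hgy y) fun a => hgK _
      have hI2 : Integrable (fun a => h i.succ (Fin.cons a y)) μ :=
        integrable_of_abs_le (hhy _ y) fun a => hhK _ _
      simp only [hG, hH]
      rw [← integral_sub hI1 hI2]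
      have hm := (hgy y).sub (hhy i.succ y)
      have hI4 : Integrable (fun a => (g (Fin.cons a y) - h i.succ (Fin.cons a y)) ^ 2) μ :=
        integrable_of_abs_le (hm.pow_const 2) (fun a => hsq _ _ (hdiff i.succ) _)
      exact (Even.convexOn_pow even_two).map_integral_le (continuousOn_pow 2) isClosed_univ
        (by simp) (hI1.sub hI2) hI4
    rw [Fin.sum_univ_succ, e1, e2, e3]
    simp_rw [e3]
    have := Finset.sum_le_sum fun i (_ : i ∈ Finset.univ) => step1 i
    linarith

section SelfBounding

open ProbabilityTheory

variable {α : Type*} [MeasurableSpace α] {μ : Measure α} [IsProbabilityMeasure μ] {N : ℕ}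
  {Z : (Fin N → α) → ℝ} {Zd : Fin N → (Fin N → α) → ℝ} {B : ℝ}

/-- Truncation at level `B` of a self-bounding family of increments. -/
lemma sum_min_sub_min_le {ι : Type*} {s : Finset ι} {z B : ℝ} {w : ι → ℝ} (hB : 0 < B)
    (hw0 : ∀ i ∈ s, 0 ≤ w i) (hwz : ∀ i ∈ s, w i ≤ z) (hsum : ∑ i ∈ s, (z - w i) ≤ z) :
    ∑ i ∈ s, (min z B - min (w i) B) ≤ B := by
  rcases le_total z B with hz | hz
  · refine (Finset.sum_le_sum fun i hi => ?_).trans (hsum.trans hz)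
    rw [min_eq_left hz, min_eq_left ((hwz i hi).trans hz)]
  · have hz0 : 0 < z := hB.trans_le hz
    calc ∑ i ∈ s, (min z B - min (w i) B) ≤ ∑ i ∈ s, B / z * (z - w i) := by
          refine Finset.sum_le_sum fun i hi => ?_
          rw [min_eq_right hz]
          have hq : B / z ≤ 1 := (div_le_one hz0).2 hz
          have hbz : B / z * z = B := div_mul_cancel₀ _ hz0.ne'
          rcases le_total (w i) B with h | h
          · rw [min_eq_left h]
            nlinarith [hw0 i hi]
          · rw [min_eq_right h, sub_self]
            exact mul_nonneg (by positivity) (sub_nonneg.2 (hwz i hi))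
      _ = B / z * ∑ i ∈ s, (z - w i) := by rw [Finset.mul_sum]
      _ ≤ B / z * z := by gcongr
      _ = B := div_mul_cancel₀ _ hz0.ne'

/-- Halving the parameter in the moment generating function of a truncated self-bounding
function. -/
lemma mgf_min_le_sq_mgf_half (hB : 0 < B) (hZ : Measurable Z) (hZd : ∀ i, Measurable (Zd i))
    (h0 : ∀ i x, 0 ≤ Zd i x) (hle : ∀ i x, Zd i x ≤ Z x) (hle1 : ∀ i x, Z x ≤ Zd i x + 1)
    (hsum : ∀ x, ∑ i, (Z x - Zd i x) ≤ Z x)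
    (hupd : ∀ i x a, Zd i (Function.update x i a) = Zd i x)
    {t : ℝ} (ht : 0 ≤ t) (htB : t ^ 2 * B ≤ 1) :
    mgf (fun x => min (Z x) B) (Measure.pi fun _ => μ) t ≤
      Real.exp (t ^ 2 * B) * mgf (fun x => min (Z x) B) (Measure.pi fun _ => μ) (t / 2) ^ 2 := by
  set π := Measure.pi fun _ : Fin N => μ
  have hYm : Measurable fun x => min (Z x) B := hZ.min measurable_const
  have hYdm : ∀ i, Measurable fun x => min (Zd i x) B := fun i => (hZd i).min measurable_const
  have hexpK : ∀ y : ℝ, |Real.exp (t / 2 * min y B)| ≤ Real.exp (t / 2 * B) := fun y => by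
    rw [Real.abs_exp]
    gcongr
    exact min_le_right _ _
  have hES := efron_stein μ N (fun x => Real.exp (t / 2 * min (Z x) B))
    (fun i x => Real.exp (t / 2 * min (Zd i x) B)) (Real.exp (t / 2 * B))
    (Real.measurable_exp.comp (hYm.const_mul _)) (fun x => hexpK _)
    (fun i => Real.measurable_exp.comp ((hYdm i).const_mul _)) (fun i x => hexpK _)
    (fun i x a => by simp only [hupd])
  have hsq : ∀ x, Real.exp (t / 2 * min (Z x) B) ^ 2 = Real.exp (t * min (Z x) B) := fun x => by
    rw [← Real.exp_nat_mul]; congr 1; push_cast; ring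
  simp only [hsq] at hES
  have hint : Integrable (fun x => Real.exp (t * min (Z x) B)) π :=
    integrable_of_abs_le (K := Real.exp (t * B)) (Real.measurable_exp.comp (hYm.const_mul _))
      fun x => by
        rw [Real.abs_exp]
        gcongr
        exact min_le_right _ _
  have hdint : ∀ i, Integrable (fun x => (Real.exp (t / 2 * min (Z x) B) -
      Real.exp (t / 2 * min (Zd i x) B)) ^ 2) π := fun i =>
    integrable_of_abs_le (K := (Real.exp (t / 2 * B) + Real.exp (t / 2 * B)) ^ 2)
      (((Real.measurable_exp.comp (hYm.const_mul _)).sub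
        (Real.measurable_exp.comp ((hYdm i).const_mul _))).pow_const 2) fun x => by
        rw [abs_pow]
        exact pow_le_pow_left₀ (abs_nonneg _)
          ((abs_sub _ _).trans (add_le_add (hexpK _) (hexpK _))) 2
  have hpt : ∀ x, ∑ i, (Real.exp (t / 2 * min (Z x) B) -
      Real.exp (t / 2 * min (Zd i x) B)) ^ 2 ≤ t ^ 2 * B / 4 * Real.exp (t * min (Z x) B) := by
    intro x
    calc _ ≤ ∑ i, t ^ 2 / 4 * Real.exp (t * min (Z x) B) * (min (Z x) B - min (Zd i x) B) := by
          refine Finset.sum_le_sum fun i _ => ?_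
          set y := min (Z x) B
          set w := min (Zd i x) B
          have hwy : w ≤ y := min_le_min_right _ (hle i x)
          have hyw : y - w ≤ 1 := by
            have : y ≤ w + 1 := by
              simp only [y, w, min_add]
              exact min_le_min (hle1 i x) (by linarith)
            linarith
          have e1 : Real.exp (t / 2 * w) = Real.exp (t / 2 * y) * Real.exp (-(t / 2 * (y - w))) := by
            rw [← Real.exp_add]; congr 1; ring
          have e2 := Real.add_one_le_exp (-(t / 2 * (y - w)))
          have e3 : Real.exp (-(t / 2 * (y - w))) ≤ 1 := Real.exp_le_one_iff.2 (by
            have := mul_nonneg (div_nonneg ht zero_le_two) (sub_nonneg.2 hwy)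
            linarith)
          have e4 : (1 - Real.exp (-(t / 2 * (y - w)))) ^ 2 ≤ (t / 2 * (y - w)) ^ 2 :=
            pow_le_pow_left₀ (by linarith) (by linarith) 2
          have e5 : (y - w) ^ 2 ≤ y - w := by nlinarith
          rw [e1, ← hsq]
          calc _ = Real.exp (t / 2 * y) ^ 2 * (1 - Real.exp (-(t / 2 * (y - w)))) ^ 2 := by ring
            _ ≤ Real.exp (t / 2 * y) ^ 2 * (t / 2 * (y - w)) ^ 2 := by gcongr
            _ = t ^ 2 / 4 * Real.exp (t / 2 * y) ^ 2 * (y - w) ^ 2 := by ring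
            _ ≤ _ := by gcongr
      _ = t ^ 2 / 4 * Real.exp (t * min (Z x) B) * ∑ i, (min (Z x) B - min (Zd i x) B) := by
          rw [Finset.mul_sum]
      _ ≤ t ^ 2 / 4 * Real.exp (t * min (Z x) B) * B := by
          gcongr
          exact sum_min_sub_min_le hB (fun i _ => h0 i x) (fun i _ => hle i x) (hsum x)
      _ = _ := by ring
  have hS : ∑ i, ∫ x, (Real.exp (t / 2 * min (Z x) B) -
      Real.exp (t / 2 * min (Zd i x) B)) ^ 2 ∂π ≤
        t ^ 2 * B / 4 * ∫ x, Real.exp (t * min (Z x) B) ∂π := by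
    rw [← integral_finsetSum _ fun i _ => hdint i, ← integral_const_mul]
    exact integral_mono (integrable_finsetSum _ fun i _ => hdint i) (hint.const_mul _) hpt
  simp only [mgf]
  set E := ∫ x, Real.exp (t * min (Z x) B) ∂π
  set E2 := ∫ x, Real.exp (t / 2 * min (Z x) B) ∂π
  have hfin : (1 - t ^ 2 * B / 4) * E ≤ E2 ^ 2 := by linarith
  have hu0 : 0 ≤ t ^ 2 * B := by positivity
  have hE0 : 0 ≤ E := integral_nonneg fun x => (Real.exp_pos _).le
  have hexp : 1 ≤ Real.exp (t ^ 2 * B) * (1 - t ^ 2 * B / 4) := by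
    have := Real.add_one_le_exp (t ^ 2 * B)
    nlinarith
  calc E ≤ Real.exp (t ^ 2 * B) * (1 - t ^ 2 * B / 4) * E := le_mul_of_one_le_left hE0 hexp
    _ = Real.exp (t ^ 2 * B) * ((1 - t ^ 2 * B / 4) * E) := by ring
    _ ≤ _ := by gcongr

/-- Upper tail bound for self-bounding functions of independent variables. -/
theorem measure_ge_le_of_selfBounding (hB : 0 < B) (hZ : Measurable Z)
    (hZd : ∀ i, Measurable (Zd i))
    (h0 : ∀ i x, 0 ≤ Zd i x) (hle : ∀ i x, Zd i x ≤ Z x) (hle1 : ∀ i x, Z x ≤ Zd i x + 1)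
    (hZ0 : ∀ x, 0 ≤ Z x)
    (hsum : ∀ x, ∑ i, (Z x - Zd i x) ≤ Z x)
    (hupd : ∀ i x a, Zd i (Function.update x i a) = Zd i x)
    (hZi : Integrable Z (Measure.pi fun _ => μ))
    {t : ℝ} (htB : ∫ x, Z x ∂(Measure.pi fun _ => μ) + t ≤ B) :
    (Measure.pi fun _ => μ).real {x | B ≤ Z x} ≤ Real.exp (3 - t / √B) := by
  set π := Measure.pi fun _ : Fin N => μ
  set Y : (Fin N → α) → ℝ := fun x => min (Z x) B with hY
  have hYm : Measurable Y := hZ.min measurable_const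
  have hY0 : ∀ x, 0 ≤ Y x := fun x => le_min (hZ0 x) hB.le
  have hYB : ∀ x, Y x ≤ B := fun x => min_le_right _ _
  have hiter : ∀ k : ℕ, ∀ s : ℝ, 0 ≤ s → s ^ 2 * B ≤ 1 →
      mgf Y π s ≤ Real.exp (2 * B * s ^ 2 * (1 - (1 / 2) ^ k)) * mgf Y π (s / 2 ^ k) ^ 2 ^ k := by
    intro k
    induction k with
    | zero => intro s _ _; simp
    | succ k ih =>
      intro s hs hsB
      have h1 := mgf_min_le_sq_mgf_half (μ := μ) hB hZ hZd h0 hle hle1 hsum hupd hs hsB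
      have h2 := ih (s / 2) (by positivity) (by nlinarith [sq_nonneg s])
      calc mgf Y π s ≤ Real.exp (s ^ 2 * B) * mgf Y π (s / 2) ^ 2 := h1
        _ ≤ Real.exp (s ^ 2 * B) * (Real.exp (2 * B * (s / 2) ^ 2 * (1 - (1 / 2) ^ k)) *
              mgf Y π (s / 2 / 2 ^ k) ^ 2 ^ k) ^ 2 := by
            gcongr
            exact mgf_nonneg
        _ = _ := by
            rw [mul_pow, ← Real.exp_nat_mul, ← pow_mul, ← mul_assoc, ← Real.exp_add, ← pow_succ,
              div_div, ← pow_succ']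
            congr 2
            push_cast
            ring
  have hHoeff : ∀ s, mgf Y π s ≤ Real.exp (s * π[Y] + s ^ 2 * B ^ 2) := by
    intro s
    have := (hasSubgaussianMGF_of_mem_Icc (μ := π) (X := Y) (a := 0) (b := B) hYm.aemeasurable
      (Eventually.of_forall fun x => ⟨hY0 x, hYB x⟩)).mgf_le s
    have e : mgf (fun x => Y x - π[Y]) π s = Real.exp (-(s * π[Y])) * mgf Y π s := by
      generalize π[Y] = m
      simp only [mgf, ← integral_const_mul, ← Real.exp_add]
      congr 1; ext x; congr 1; ring
    rw [e] at this
    have hb : (((‖B - 0‖₊ / 2) ^ 2 : NNReal) : ℝ) = (B / 2) ^ 2 := by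
      simp [abs_of_pos hB]
    rw [hb] at this
    calc mgf Y π s = Real.exp (s * π[Y]) * (Real.exp (-(s * π[Y])) * mgf Y π s) := by
          rw [← mul_assoc, ← Real.exp_add]; simp
      _ ≤ Real.exp (s * π[Y]) * Real.exp ((B / 2) ^ 2 * s ^ 2 / 2) := by gcongr
      _ ≤ _ := by
          rw [← Real.exp_add]
          gcongr
          nlinarith [mul_nonneg (sq_nonneg B) (sq_nonneg s)]
  obtain ⟨k, hk⟩ := pow_unbounded_of_one_lt B (one_lt_two)
  set s := 1 / √B with hs
  have hsB0 : 0 < √B := Real.sqrt_pos.2 hB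
  have hs0 : 0 ≤ s := by positivity
  have hsB : s ^ 2 * B = 1 := by
    rw [hs, div_pow, one_pow, Real.sq_sqrt hB.le]; field_simp
  have hmgf : mgf Y π s ≤ Real.exp (s * π[Y] + 3) := by
    refine (hiter k s hs0 hsB.le).trans ?_
    calc _ ≤ Real.exp 2 * Real.exp ((s / 2 ^ k) * π[Y] + (s / 2 ^ k) ^ 2 * B ^ 2) ^ 2 ^ k := by
          gcongr
          · exact pow_nonneg mgf_nonneg _
          · nlinarith [pow_pos (one_half_pos (α := ℝ)) k]
          · exact mgf_nonneg
          · exact hHoeff _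
      _ = Real.exp (s * π[Y] + (2 + (s ^ 2 * B) * (B / 2 ^ k))) := by
          rw [← Real.exp_nat_mul, ← Real.exp_add]
          congr 1
          push_cast
          field_simp
          ring
      _ ≤ _ := by
          rw [hsB]
          have : B / 2 ^ k ≤ 1 := (div_le_one (by positivity)).2 hk.le
          gcongr
          linarith
  have hmono : ∫ x, Y x ∂π ≤ ∫ x, Z x ∂π :=
    integral_mono (integrable_of_abs_le (K := B) hYm fun x => by
      rw [abs_of_nonneg (hY0 x)]; exact hYB x) hZi fun x => min_le_left _ _
  have hset : {x | B ≤ Z x} = {x | B ≤ Y x} := by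
    ext x; simp [hY]
  rw [hset]
  refine (measure_ge_le_exp_mul_mgf B hs0 (integrable_of_abs_le (K := Real.exp (s * B))
    (Real.measurable_exp.comp (hYm.const_mul _)) fun x => ?_)).trans ?_
  · rw [Real.abs_exp]
    gcongr
    exact hYB x
  · calc _ ≤ Real.exp (-s * B) * Real.exp (s * π[Y] + 3) := by gcongr
      _ ≤ _ := by
        rw [← Real.exp_add]
        gcongr
        have : t / √B = s * t := by rw [hs]; ring
        rw [this]
        nlinarith

end SelfBounding

section IndexChain

variable {ι E : Type*} [LE E]

/-- The indices in `S` carry pairwise comparable values of `X`. -/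
def IndexChain (S : Finset ι) (X : ι → E) : Prop :=
  ∀ i ∈ S, ∀ j ∈ S, X i ≤ X j ∨ X j ≤ X i

open Classical in
/-- The largest number of indices in `s` carrying pairwise comparable values of `X`. -/
def chainCount (s : Finset ι) (X : ι → E) : ℕ :=
  s.powerset.sup fun S => if IndexChain S X then S.card else 0

lemma le_chainCount {s S : Finset ι} {X : ι → E} (hS : S ⊆ s) (hX : IndexChain S X) :
    S.card ≤ chainCount s X := by
  classical
  refine le_trans ?_ (Finset.le_sup (f := fun S => if IndexChain S X then S.card else 0)
    (Finset.mem_powerset.2 hS))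
  rw [if_pos hX]

lemma exists_indexChain_card_eq (s : Finset ι) (X : ι → E) :
    ∃ S ⊆ s, IndexChain S X ∧ S.card = chainCount s X := by
  classical
  obtain ⟨S, hS, h⟩ := Finset.exists_mem_eq_sup s.powerset ⟨∅, by simp⟩
    (fun S => if IndexChain S X then S.card else 0)
  by_cases hc : IndexChain S X
  · exact ⟨S, Finset.mem_powerset.1 hS, hc, by rw [chainCount, h, if_pos hc]⟩
  · exact ⟨∅, by simp, by simp [IndexChain], by rw [chainCount, h, if_neg hc]; simp⟩

lemma chainCount_le_card (s : Finset ι) (X : ι → E) : chainCount s X ≤ s.card := by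
  obtain ⟨S, hS, -, h⟩ := exists_indexChain_card_eq s X
  exact h ▸ Finset.card_le_card hS

lemma chainCount_mono {s s' : Finset ι} (h : s ⊆ s') (X : ι → E) :
    chainCount s X ≤ chainCount s' X := by
  obtain ⟨S, hS, hc, hcard⟩ := exists_indexChain_card_eq s X
  exact hcard ▸ le_chainCount (hS.trans h) hc

lemma chainCount_le_erase_add_one [DecidableEq ι] (s : Finset ι) (X : ι → E) (i : ι) :
    chainCount s X ≤ chainCount (s.erase i) X + 1 := by
  obtain ⟨S, hS, hc, hcard⟩ := exists_indexChain_card_eq s X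
  have := le_chainCount (X := X) (Finset.erase_subset_erase i hS)
    (fun a ha b hb => hc a (Finset.mem_of_mem_erase ha) b (Finset.mem_of_mem_erase hb))
  have h2 := Finset.pred_card_le_card_erase (s := S) (a := i)
  omega

lemma sum_chainCount_sub_erase_le [Fintype ι] [DecidableEq ι] (X : ι → E) :
    ∑ i, ((chainCount Finset.univ X : ℝ) - chainCount (Finset.univ.erase i) X) ≤
      chainCount Finset.univ X := by
  obtain ⟨S, hS, hc, hcard⟩ := exists_indexChain_card_eq Finset.univ X
  calc ∑ i, ((chainCount Finset.univ X : ℝ) - chainCount (Finset.univ.erase i) X)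
      ≤ ∑ i, (if i ∈ S then (1 : ℝ) else 0) := by
        refine Finset.sum_le_sum fun i _ => ?_
        split_ifs with hi
        · have := chainCount_le_erase_add_one Finset.univ X i
          have : (chainCount Finset.univ X : ℝ) ≤ chainCount (Finset.univ.erase i) X + 1 := by
            exact_mod_cast this
          linarith
        · have h1 : S.card ≤ chainCount (Finset.univ.erase i) X :=
            le_chainCount (fun a ha => by
              simp only [Finset.mem_erase, Finset.mem_univ, and_true]
              rintro rfl
              exact hi ha) hc
          rw [hcard] at h1
          have : (chainCount Finset.univ X : ℝ) ≤ chainCount (Finset.univ.erase i) X := by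
            exact_mod_cast h1
          linarith
    _ = chainCount Finset.univ X := by simp [← hcard]

lemma chainCount_erase_update [DecidableEq ι] (s : Finset ι) (X : ι → E) (i : ι) (a : E) :
    chainCount (s.erase i) (Function.update X i a) = chainCount (s.erase i) X := by
  classical
  unfold chainCount
  refine Finset.sup_congr rfl fun S hS => ?_
  have hi : ∀ j ∈ S, Function.update X i a j = X j := fun j hj => by
    rw [Function.update_of_ne]
    exact Finset.ne_of_mem_erase (Finset.mem_powerset.1 hS hj)
  have : IndexChain S (Function.update X i a) ↔ IndexChain S X := by
    unfold IndexChain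
    constructor
    · intro h j hj k hk
      simpa [hi j hj, hi k hk] using h j hj k hk
    · intro h j hj k hk
      simpa [hi j hj, hi k hk] using h j hj k hk
  simp only [this]

end IndexChain

lemma measurableSet_indexChain {d N : ℕ} (S : Finset (Fin N)) :
    MeasurableSet {X : Fin N → Fin d → ℝ | IndexChain S X} := by
  have : {X : Fin N → Fin d → ℝ | IndexChain S X} =
      ⋂ i ∈ S, ⋂ j ∈ S, ({X | X i ≤ X j} ∪ {X | X j ≤ X i}) := by
    ext X; simp [IndexChain]
  rw [this]
  refine S.measurableSet_biInter fun i _ => S.measurableSet_biInter fun j _ => ?_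
  exact (measurableSet_le (measurable_pi_apply i) (measurable_pi_apply j)).union
    (measurableSet_le (measurable_pi_apply j) (measurable_pi_apply i))

lemma measurable_chainCount {d N : ℕ} (s : Finset (Fin N)) :
    Measurable fun X : Fin N → Fin d → ℝ => chainCount s X := by
  classical
  refine measurable_of_Ici fun k => ?_
  have : (fun X : Fin N → Fin d → ℝ => chainCount s X) ⁻¹' Set.Ici k =
      ⋃ S ∈ s.powerset.filter fun S => k ≤ S.card, {X | IndexChain S X} := by
    ext X
    simp only [Set.mem_preimage, Set.mem_Ici, Set.mem_iUnion, Finset.mem_filter,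
      Finset.mem_powerset, Set.mem_ofPred_eq, exists_prop]
    constructor
    · intro h
      obtain ⟨S, hS, hc, hcard⟩ := exists_indexChain_card_eq s X
      exact ⟨S, ⟨hS, hcard ▸ h⟩, hc⟩
    · rintro ⟨S, ⟨hS, hk⟩, hc⟩
      exact hk.trans (le_chainCount hS hc)
  rw [this]
  exact Finset.measurableSet_biUnion _ fun S _ => measurableSet_indexChain S

lemma chainLength_range_le {d N : ℕ} (X : Fin N → Fin d → ℝ) :
    chainLength d (Set.range X) ≤ chainCount Finset.univ X := by
  classical
  refine csSup_le' ?_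
  rintro n ⟨C, hC, hch, rfl⟩
  rcases C.eq_empty_or_nonempty with rfl | ⟨z₀, hz₀⟩
  · simp
  obtain ⟨i₀, -⟩ := hC hz₀
  have : Nonempty (Fin N) := ⟨i₀⟩
  choose! g hg using fun z (hz : z ∈ C) => (hC hz : z ∈ Set.range X)
  have hinj : Set.InjOn g C := fun z hz w hw h => by rw [← hg z hz, ← hg w hw, h]
  rw [← Finset.card_image_of_injOn hinj]
  refine le_chainCount (Finset.subset_univ _) fun i hi j hj => ?_
  obtain ⟨z, hz, rfl⟩ := Finset.mem_image.1 hi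
  obtain ⟨w, hw, rfl⟩ := Finset.mem_image.1 hj
  rw [hg z hz, hg w hw]
  exact hch.total hz hw

lemma chainCount_le_chainLength_range {d N : ℕ} {X : Fin N → Fin d → ℝ}
    (hX : Function.Injective X) :
    chainCount Finset.univ X ≤ chainLength d (Set.range X) := by
  classical
  obtain ⟨S, -, hc, hcard⟩ := exists_indexChain_card_eq Finset.univ X
  refine le_csSup ⟨(Set.finite_range X).toFinset.card, ?_⟩ ⟨S.image X, ?_, ?_, ?_⟩
  · rintro n ⟨C, hC, -, rfl⟩
    exact Finset.card_le_card fun z hz => by simpa using hC hz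
  · intro z hz
    obtain ⟨i, -, rfl⟩ := Finset.mem_image.1 (Finset.mem_coe.1 hz)
    exact ⟨i, rfl⟩
  · rintro z hz w hw -
    obtain ⟨i, hi, rfl⟩ := Finset.mem_image.1 (Finset.mem_coe.1 hz)
    obtain ⟨j, hj, rfl⟩ := Finset.mem_image.1 (Finset.mem_coe.1 hw)
    exact hc i hi j hj
  · rw [Finset.card_image_of_injective _ hX, hcard]

/-- The uniform distribution on the unit cube. -/
abbrev cubeMeasure (d : ℕ) : Measure (Fin d → ℝ) :=
  volume.restrict (Set.Icc (0 : Fin d → ℝ) 1)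

instance (d : ℕ) : IsProbabilityMeasure (cubeMeasure d) :=
  ⟨by simp [Real.volume_Icc_pi]⟩

/-- Independent uniform points of the cube are almost surely distinct. -/
lemma ae_injective_cubeMeasure {d : ℕ} (hd : 0 < d) (N : ℕ) :
    ∀ᵐ X ∂(Measure.pi fun _ : Fin N => cubeMeasure d), Function.Injective X := by
  have hr : (Measure.pi fun _ : Fin N => cubeMeasure d) =
      (volume : Measure (Fin N → Fin d → ℝ)).restrict
        (Set.univ.pi fun _ => Set.Icc (0 : Fin d → ℝ) 1) :=
    (Measure.restrict_pi_pi (fun _ : Fin N => (volume : Measure (Fin d → ℝ))) _).symm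
  rw [hr]
  refine ae_restrict_of_ae ?_
  have : ∀ i j : Fin N, i ≠ j → ∀ᵐ X : Fin N → Fin d → ℝ, X i ≠ X j := by
    intro i j hij
    let W : Submodule ℝ (Fin N → Fin d → ℝ) :=
      LinearMap.ker (LinearMap.proj (R := ℝ) (φ := fun _ : Fin N => Fin d → ℝ) i -
        LinearMap.proj j)
    have hW : W ≠ ⊤ := by
      intro h
      have hmem : (Function.update 0 i 1 : Fin N → Fin d → ℝ) ∈ W := h ▸ Submodule.mem_top
      have h1 : (1 : Fin d → ℝ) = 0 := by
        simpa [W, LinearMap.mem_ker, hij.symm] using hmem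
      exact one_ne_zero (congrFun h1 ⟨0, hd⟩)
    have h0 := Measure.addHaar_submodule (volume : Measure (Fin N → Fin d → ℝ)) W hW
    rw [ae_iff]
    convert h0 using 2
    ext X
    simp [W, LinearMap.mem_ker, sub_eq_zero]
  have h2 : ∀ᵐ X : Fin N → Fin d → ℝ, ∀ i j : Fin N, i ≠ j → X i ≠ X j := by
    rw [ae_all_iff]; intro i
    rw [ae_all_iff]; intro j
    by_cases hij : i = j
    · simp [hij]
    · filter_upwards [this i j hij] with X hX _ using hX
  filter_upwards [h2] with X hX i j hij
  by_contra hne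
  exact hX i j hne hij

lemma integral_chainCount {d : ℕ} (hd : 0 < d) (N : ℕ) :
    ∫ X, (chainCount Finset.univ X : ℝ) ∂(Measure.pi fun _ : Fin N => cubeMeasure d) =
      BWexpect d N := by
  refine integral_congr_ae ?_
  filter_upwards [ae_injective_cubeMeasure hd N] with X hX
  exact_mod_cast le_antisymm (chainCount_le_chainLength_range hX) (chainLength_range_le X)

/-- Upper tail of the longest chain among `N` independent uniform points. -/
theorem measure_chainCount_ge_le {d : ℕ} (hd : 0 < d) (N : ℕ) {B t : ℝ} (hB : 0 < B)
    (htB : BWexpect d N + t ≤ B) :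
    (Measure.pi fun _ : Fin N => cubeMeasure d).real
      {X | B ≤ (chainCount Finset.univ X : ℝ)} ≤ Real.exp (3 - t / √B) := by
  have hm : ∀ s : Finset (Fin N),
      Measurable fun X : Fin N → Fin d → ℝ => (chainCount s X : ℝ) := fun s =>
    measurable_from_nat.comp (measurable_chainCount s)
  refine measure_ge_le_of_selfBounding (μ := cubeMeasure d)
    (Zd := fun i X => (chainCount (Finset.univ.erase i) X : ℝ)) hB (hm _) (fun i => hm _)
    (fun i X => Nat.cast_nonneg _)
    (fun i X => Nat.cast_le.2 (chainCount_mono (Finset.erase_subset _ _) X))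
    (fun i X => by exact_mod_cast chainCount_le_erase_add_one Finset.univ X i)
    (fun X => Nat.cast_nonneg _) (fun X => sum_chainCount_sub_erase_le X)
    (fun i X a => by rw [chainCount_erase_update])
    (integrable_of_abs_le (K := N) (hm _) fun X => ?_) ?_
  · rw [Nat.abs_cast]
    exact_mod_cast (chainCount_le_card _ X).trans (by simp)
  · rwa [integral_chainCount hd N]

section Occupancy

variable {ι : Type*} [Fintype ι]

lemma prod_X_pow_eq_monomial (k : ι → ℕ) :
    ∏ q, (MvPolynomial.X q : MvPolynomial ι ℕ) ^ k q =
      MvPolynomial.monomial (Finsupp.equivFunOnFinite.symm k) 1 := by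
  rw [MvPolynomial.monomial_eq, Finsupp.prod_fintype _ _ (by simp)]
  simp

variable [DecidableEq ι]

/-- The number of indices sent to each cell. -/
def occupancy {N : ℕ} (Y : Fin N → ι) : ι → ℕ := fun q => (Finset.univ.filter (Y · = q)).card

lemma sum_occupancy {N : ℕ} (Y : Fin N → ι) : ∑ q, occupancy Y q = N := by
  simpa [occupancy] using
    (Finset.card_eq_sum_card_fiberwise (f := Y) (s := Finset.univ) (t := Finset.univ)
      (fun _ _ => by simp)).symm

lemma prod_comp_eq_prod_pow_occupancy {R : Type*} [CommMonoid R] {N : ℕ} (Y : Fin N → ι)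
    (f : ι → R) : ∏ j, f (Y j) = ∏ q, f q ^ occupancy Y q := by
  rw [← Finset.prod_fiberwise Finset.univ Y]
  refine Finset.prod_congr rfl fun q _ => ?_
  rw [occupancy, Finset.prod_congr rfl (g := fun _ => f q), Finset.prod_const]
  intro j hj
  rw [(Finset.mem_filter.1 hj).2]

/-- The number of functions with prescribed fibre sizes is a multinomial coefficient. -/
lemma card_occupancy_eq {N : ℕ} {κ : ι → ℕ} (hκ : ∑ q, κ q = N) :
    (Finset.univ.filter fun Y : Fin N → ι => occupancy Y = κ).card =
      Nat.multinomial Finset.univ κ := by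
  have h1 : (∑ q, (MvPolynomial.X q : MvPolynomial ι ℕ)) ^ N =
      ∑ Y : Fin N → ι, MvPolynomial.monomial (Finsupp.equivFunOnFinite.symm (occupancy Y)) 1 := by
    rw [Fintype.sum_pow]
    refine Finset.sum_congr rfl fun Y _ => ?_
    rw [prod_comp_eq_prod_pow_occupancy, prod_X_pow_eq_monomial]
  rw [Finset.sum_pow_eq_sum_piAntidiag] at h1
  have h2 := congrArg (MvPolynomial.coeff (Finsupp.equivFunOnFinite.symm κ)) h1
  simp only [prod_X_pow_eq_monomial, MvPolynomial.coeff_sum, MvPolynomial.coeff_monomial,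
    ← MvPolynomial.C_eq_coe_nat, MvPolynomial.coeff_C_mul, EmbeddingLike.apply_eq_iff_eq,
    mul_ite, mul_one, mul_zero, Finset.sum_ite_eq', Finset.mem_piAntidiag] at h2
  rw [Finset.card_filter, ← h2]
  simp [hκ]

lemma card_occupancy_div_factorial {N : ℕ} {κ : ι → ℕ} (hκ : ∑ q, κ q = N) :
    ((Finset.univ.filter fun Y : Fin N → ι => occupancy Y = κ).card : ℝ) / N.factorial =
      ∏ q, ((κ q).factorial : ℝ)⁻¹ := by
  have h := Nat.multinomial_spec Finset.univ κ
  rw [hκ, ← card_occupancy_eq hκ] at h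
  rw [← h, Finset.prod_inv_distrib]
  have h0 : (∏ q, ((κ q).factorial : ℝ)) ≠ 0 :=
    Finset.prod_ne_zero_iff.2 fun q _ => by positivity
  have h1 : ((Finset.univ.filter fun Y : Fin N → ι => occupancy Y = κ).card : ℝ) ≠ 0 := by
    intro h2
    rw [Nat.cast_eq_zero] at h2
    rw [h2, mul_zero] at h
    exact N.factorial_ne_zero h.symm
  push_cast
  field_simp

end Occupancy

section Poisson

open ProbabilityTheory
open scoped NNReal ENNReal

variable {ι : Type*} [Fintype ι]

/-- Stochastic monotonicity of products of Poisson laws in their rates. -/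
lemma pi_poissonMeasure_mono {a b : ι → ℝ≥0} (hab : ∀ q, a q ≤ b q) {U : Set (ι → ℕ)}
    (hU : IsUpperSet U) :
    Measure.pi (fun q => poissonMeasure (a q)) U ≤ Measure.pi (fun q => poissonMeasure (b q)) U := by
  set π := Measure.pi fun q => (poissonMeasure (a q)).prod (poissonMeasure (b q - a q))
  have ha : Measure.pi (fun q => poissonMeasure (a q)) = π.map fun x q => (x q).1 := by
    have hfst : ∀ q, (poissonMeasure (a q)) =
        ((poissonMeasure (a q)).prod (poissonMeasure (b q - a q))).map (fun p => p.1) := fun q => by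
      change _ = Measure.map Prod.fst _
      rw [Measure.map_fst_prod]; simp
    have : ∀ q, IsProbabilityMeasure
        (((poissonMeasure (a q)).prod (poissonMeasure (b q - a q))).map fun p => p.1) :=
      fun q => Measure.isProbabilityMeasure_map measurable_fst.aemeasurable
    rw [Measure.pi_map_pi (f := fun _ (p : ℕ × ℕ) => p.1) (fun q => measurable_fst.aemeasurable)]
    simp only [← hfst]
  have hb : Measure.pi (fun q => poissonMeasure (b q)) = π.map fun x q => (x q).1 + (x q).2 := by
    have hadd : ∀ q, (poissonMeasure (b q)) =
        ((poissonMeasure (a q)).prod (poissonMeasure (b q - a q))).map fun p => p.1 + p.2 :=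
      fun q => by
      conv_lhs => rw [← add_tsub_cancel_of_le (hab q), ← poissonMeasure_conv_poissonMeasure]
      rfl
    have : ∀ q, IsProbabilityMeasure (((poissonMeasure (a q)).prod
        (poissonMeasure (b q - a q))).map fun p => p.1 + p.2) :=
      fun q => Measure.isProbabilityMeasure_map (measurable_fst.add measurable_snd).aemeasurable
    rw [Measure.pi_map_pi (f := fun _ (p : ℕ × ℕ) => p.1 + p.2)
      (fun q => (measurable_fst.add measurable_snd).aemeasurable)]
    simp only [← hadd]
  have hUm : MeasurableSet U := U.to_countable.measurableSet
  rw [ha, hb, Measure.map_apply (by fun_prop) hUm, Measure.map_apply (by fun_prop) hUm]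
  refine measure_mono fun x hx => hU (fun q => ?_) hx
  exact Nat.le_add_right _ _

variable [DecidableEq ι] {α : Type*} [MeasurableSpace α]

/-- The law of the occupancy numbers of `N` independent points. -/
lemma pi_occupancy_eq (ν : Measure α) [IsProbabilityMeasure ν] [MeasurableSpace ι]
    [MeasurableSingletonClass ι] {cell : α → ι} (hcell : Measurable cell) {N : ℕ} (κ : ι → ℕ) :
    Measure.pi (fun _ : Fin N => ν) {X | occupancy (cell ∘ X) = κ} =
      (Finset.univ.filter fun Y : Fin N → ι => occupancy Y = κ).card *
        ∏ q, ν (cell ⁻¹' {q}) ^ κ q := by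
  have hset : {X : Fin N → α | occupancy (cell ∘ X) = κ} =
      ⋃ Y ∈ (Finset.univ.filter fun Y : Fin N → ι => occupancy Y = κ),
        Set.univ.pi fun j => cell ⁻¹' {Y j} := by
    ext X
    simp only [Set.mem_ofPred_eq, Set.mem_iUnion, Finset.mem_filter, Finset.mem_univ, true_and,
      Set.mem_pi, Set.mem_preimage, Set.mem_singleton_iff, exists_prop]
    constructor
    · intro h
      exact ⟨cell ∘ X, h, fun j _ => rfl⟩
    · rintro ⟨Y, hY, h⟩
      have : cell ∘ X = Y := funext fun j => h j (Set.mem_univ j)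
      rw [this, hY]
  rw [hset, measure_biUnion_finset]
  · rw [Finset.sum_congr rfl (g := fun _ => ∏ q, ν (cell ⁻¹' {q}) ^ κ q), Finset.sum_const,
      nsmul_eq_mul]
    intro Y hY
    rw [Measure.pi_pi, prod_comp_eq_prod_pow_occupancy Y (fun q => ν (cell ⁻¹' {q})),
      (Finset.mem_filter.1 hY).2]
  · intro Y _ Y' _ hne
    rw [Function.onFun, Set.disjoint_left]
    intro X hX hX'
    refine hne (funext fun j => ?_)
    have h1 := hX j (Set.mem_univ j)
    have h2 := hX' j (Set.mem_univ j)
    simp only [Set.mem_preimage, Set.mem_singleton_iff] at h1 h2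
    rw [← h1, h2]
  · intro Y _
    exact MeasurableSet.univ_pi fun j => hcell (measurableSet_singleton _)

/-- Occupancy numbers of a Poisson number of independent points are independent Poisson. -/
lemma pi_poissonMeasure_eq_tsum (ν : Measure α) [IsProbabilityMeasure ν] [MeasurableSpace ι]
    [MeasurableSingletonClass ι] {cell : α → ι} (hcell : Measurable cell) (m : ℝ≥0)
    {p : ι → ℝ≥0} (hpν : ∀ q, ν (cell ⁻¹' {q}) = p q) (U : Set (ι → ℕ)) :
    Measure.pi (fun q => poissonMeasure (m * p q)) U =
      ∑' N, poissonMeasure m {N} *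
        Measure.pi (fun _ : Fin N => ν) {X | occupancy (cell ∘ X) ∈ U} := by
  have hpsum : ∑ q, (p q : ℝ) = 1 := by
    have h1 : ∑ q, ν (cell ⁻¹' {q}) = 1 := by
      rw [sum_measure_preimage_singleton _ fun q _ => hcell (measurableSet_singleton q)]
      simp
    simp only [hpν] at h1
    exact_mod_cast h1
  have hocc : ∀ N, Measurable fun X : Fin N → α => occupancy (cell ∘ X) := fun N => by
    have h1 : Measurable fun X : Fin N → α => cell ∘ X :=
      measurable_pi_lambda _ fun j => hcell.comp (measurable_pi_apply j)
    have h2 : Measurable (occupancy : (Fin N → ι) → ι → ℕ) := measurable_of_finite _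
    exact h2.comp h1
  have hUm : MeasurableSet U := U.to_countable.measurableSet
  have hN : ∀ N, Measure.pi (fun _ : Fin N => ν) {X | occupancy (cell ∘ X) ∈ U} =
      ∑' κ, U.indicator (fun κ =>
        Measure.pi (fun _ : Fin N => ν) {X | occupancy (cell ∘ X) = κ}) κ := fun N => by
    have h1 := Measure.tsum_indicator_apply_singleton
      ((Measure.pi fun _ : Fin N => ν).map fun X => occupancy (cell ∘ X)) U hUm
    rw [Measure.map_apply (hocc N) hUm] at h1
    refine h1.symm.trans (tsum_congr fun κ => ?_)
    simp only [Set.indicator]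
    split_ifs
    · rw [Measure.map_apply (hocc N) (measurableSet_singleton _)]; rfl
    · rfl
  simp only [hN, ← ENNReal.tsum_mul_left]
  rw [ENNReal.tsum_comm, ← Measure.tsum_indicator_apply_singleton _ U hUm]
  refine tsum_congr fun κ => ?_
  by_cases hκ : κ ∈ U
  · simp only [Set.indicator_of_mem hκ]
    rw [tsum_eq_single (∑ q, κ q)]
    · rw [pi_occupancy_eq ν hcell, Measure.pi_singleton]
      simp only [poissonMeasure_singleton, hpν]
      rw [← ENNReal.ofReal_prod_of_nonneg fun q _ => by positivity]
      have hR : ((Finset.univ.filter fun Y : Fin (∑ q, κ q) → ι => occupancy Y = κ).card : ℝ≥0∞) *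
          ∏ q, (p q : ℝ≥0∞) ^ κ q = ENNReal.ofReal
            ((Finset.univ.filter fun Y : Fin (∑ q, κ q) → ι => occupancy Y = κ).card *
              ∏ q, (p q : ℝ) ^ κ q) := by
        rw [ENNReal.ofReal_mul (by positivity), ENNReal.ofReal_natCast,
          ENNReal.ofReal_prod_of_nonneg fun q _ => by positivity]
        congr 1
        refine Finset.prod_congr rfl fun q _ => ?_
        rw [ENNReal.ofReal_pow (by positivity), ENNReal.ofReal_coe_nnreal]
      rw [hR, ← ENNReal.ofReal_mul (by positivity)]
      congr 1
      have hc := card_occupancy_div_factorial (κ := κ) rfl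
      simp only [div_eq_mul_inv, Finset.prod_mul_distrib, NNReal.coe_mul, mul_pow,
        ← Real.exp_sum, Finset.sum_neg_distrib, ← Finset.mul_sum, hpsum, mul_one,
        Finset.prod_pow_eq_pow_sum, ← hc]
      ring
    · intro N hne
      have : {X : Fin N → α | occupancy (cell ∘ X) = κ} = ∅ := by
        ext X
        simp only [Set.mem_ofPred_eq, Set.mem_empty_iff_false, iff_false]
        rintro rfl
        exact hne (sum_occupancy _).symm
      rw [this, measure_empty, mul_zero]
  · simp [Set.indicator_of_notMem hκ]

end Poisson

section CellCounts

open ProbabilityTheory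
open scoped NNReal ENNReal

/-- Occupancy numbers for which some chain of cells holds at least `k` points in total. -/
def chainOccupancies (ι : Type*) [LE ι] (k : ℕ) : Set (ι → ℕ) :=
  {κ | ∃ T : Finset ι, IsChain (· ≤ ·) (T : Set ι) ∧ k ≤ ∑ q ∈ T, κ q}

lemma isUpperSet_chainOccupancies (ι : Type*) [LE ι] (k : ℕ) :
    IsUpperSet (chainOccupancies ι k) := by
  rintro κ κ' h ⟨T, hT, hk⟩
  exact ⟨T, hT, hk.trans (Finset.sum_le_sum fun q _ => h q)⟩

lemma le_chainCount_of_occupancy_mem {ι : Type*} [Preorder ι] [DecidableEq ι] {N k : ℕ}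
    {Y : Fin N → ι} (h : occupancy Y ∈ chainOccupancies ι k) :
    k ≤ chainCount Finset.univ Y := by
  obtain ⟨T, hT, hk⟩ := h
  have hcard : (Finset.univ.filter (Y · ∈ T)).card = ∑ q ∈ T, occupancy Y q := by
    rw [Finset.card_eq_sum_card_fiberwise (f := Y) (t := T) (fun j hj => by simpa using hj)]
    refine Finset.sum_congr rfl fun q hq => ?_
    rw [occupancy, Finset.filter_filter]
    congr 1
    ext j
    simp only [Finset.mem_filter, Finset.mem_univ, true_and, and_iff_right_iff_imp]
    rintro rfl
    exact hq
  rw [← hcard] at hk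
  refine hk.trans (le_chainCount (Finset.subset_univ _) fun i hi j hj => ?_)
  exact hT.total (by simpa using hi) (by simpa using hj)

variable {d : ℕ} {Ω : Type*} [MeasurableSpace Ω] {P : Measure Ω}
  {g : (Fin d → ℝ) → ℝ}

lemma PoissonPP.measure_count_eq (PP : PoissonPP d P g) (hg : ∀ x, 0 ≤ g x)
    {A : Set (Fin d → ℝ)} (hA : MeasurableSet A) (hAb : Bornology.IsBounded A) (k : ℕ) :
    P {ω | (PP.pts ω ∩ A).encard = k} = poissonMeasure (∫ x in A, g x).toNNReal {k} := by
  rw [PP.poisson A hA hAb, poissonMeasure_singleton,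
    Real.coe_toNNReal _ (integral_nonneg fun x => hg x)]

/-- The joint law of the counts in finitely many disjoint cells. -/
lemma PoissonPP.measure_counts_mem_le (PP : PoissonPP d P g) (hg : ∀ x, 0 ≤ g x)
    {ι : Type*} [Fintype ι] {A : ι → Set (Fin d → ℝ)} (hA : ∀ q, MeasurableSet (A q))
    (hAb : ∀ q, Bornology.IsBounded (A q)) (hdisj : Pairwise fun q r => Disjoint (A q) (A r))
    (U : Set (ι → ℕ)) :
    P {ω | ∃ κ ∈ U, ∀ q, (PP.pts ω ∩ A q).encard = κ q} ≤
      Measure.pi (fun q => poissonMeasure (∫ x in A q, g x).toNNReal) U := by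
  classical
  have hset : {ω | ∃ κ ∈ U, ∀ q, (PP.pts ω ∩ A q).encard = κ q} =
      ⋃ κ ∈ U, ⋂ q, {ω | (PP.pts ω ∩ A q).encard = κ q} := by
    ext ω; simp
  have hone : ∀ κ : ι → ℕ, P (⋂ q, {ω | (PP.pts ω ∩ A q).encard = κ q}) =
      Measure.pi (fun q => poissonMeasure (∫ x in A q, g x).toNNReal) {κ} := fun κ => by
    set e := Fintype.equivFin ι
    have h := PP.indep (Fintype.card ι) (fun i => A (e.symm i)) (fun i => hA _) (fun i => hAb _)
      (fun i j hij => hdisj (e.symm.injective.ne hij)) (fun i => κ (e.symm i))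
    rw [Measure.pi_singleton, ← Equiv.prod_comp e.symm]
    simp only [PP.measure_count_eq hg (hA _) (hAb _)] at h
    rw [← h]
    congr 1
    exact (e.symm.surjective.iInter_comp
      (fun q => {ω | (PP.pts ω ∩ A q).encard = κ q})).symm
  rw [hset]
  refine (measure_biUnion_le P U.to_countable _).trans (le_of_eq ?_)
  rw [← Measure.tsum_indicator_apply_singleton _ U U.to_countable.measurableSet,
    ← tsum_subtype]
  exact tsum_congr fun κ => hone κ

variable [IsProbabilityMeasure P]

lemma PoissonPP.ae_count_ne_top (PP : PoissonPP d P g) (hg : ∀ x, 0 ≤ g x)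
    {A : Set (Fin d → ℝ)} (hA : MeasurableSet A) (hAb : Bornology.IsBounded A) :
    ∀ᵐ ω ∂P, (PP.pts ω ∩ A).encard ≠ ⊤ := by
  set s : ℕ → Set Ω := fun k => {ω | (PP.pts ω ∩ A).encard = k}
  have hs : ∀ k, MeasurableSet (s k) := fun k => PP.measur A hA hAb k
  have hdisj : Pairwise (Function.onFun Disjoint s) := by
    intro k k' hne
    rw [Function.onFun, Set.disjoint_left]
    intro ω h h'
    simp only [s, Set.mem_ofPred_eq] at h h'
    rw [h] at h'
    exact hne (by exact_mod_cast h')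
  have h1 : P (⋃ k, s k) = 1 := by
    rw [measure_iUnion hdisj hs]
    simp only [s, PP.measure_count_eq hg hA hAb]
    have := Measure.tsum_indicator_apply_singleton
      (poissonMeasure (∫ x in A, g x).toNNReal) Set.univ MeasurableSet.univ
    simpa using this
  have h2 : ∀ᵐ ω ∂P, ω ∈ ⋃ k, s k := by
    rw [← prob_compl_eq_zero_iff (MeasurableSet.iUnion hs)] at h1
    exact measure_eq_zero_iff_ae_notMem.1 h1 |>.mono fun ω h => by simpa using h
  filter_upwards [h2] with ω hω htop
  obtain ⟨k, hk⟩ := Set.mem_iUnion.1 hω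
  simp only [s, Set.mem_ofPred_eq] at hk
  rw [htop] at hk
  exact ENat.top_ne_natCast k hk

/-- Long chains of a Poisson process force large counts along a chain of cells. -/
lemma PoissonPP.measure_exists_chain_le (PP : PoissonPP d P g) (hg : ∀ x, 0 ≤ g x)
    {ι : Type*} [Fintype ι] [Preorder ι] [MeasurableSpace ι] [MeasurableSingletonClass ι]
    {R : Set (Fin d → ℝ)} (hR : MeasurableSet R) (hRb : Bornology.IsBounded R)
    {cell : (Fin d → ℝ) → ι} (hcell : Measurable cell) (hmono : Monotone cell) (k : ℕ) :
    P {ω | ∃ C : Finset (Fin d → ℝ), ↑C ⊆ PP.pts ω ∩ R ∧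
        IsChain (· ≤ ·) (C : Set (Fin d → ℝ)) ∧ k ≤ C.card} ≤
      Measure.pi (fun q => poissonMeasure (∫ x in R ∩ cell ⁻¹' {q}, g x).toNNReal)
        (chainOccupancies ι k) := by
  classical
  have hA : ∀ q, MeasurableSet (R ∩ cell ⁻¹' {q}) := fun q =>
    hR.inter (hcell (measurableSet_singleton q))
  have hAb : ∀ q, Bornology.IsBounded (R ∩ cell ⁻¹' {q}) := fun q =>
    hRb.subset Set.inter_subset_left
  have hdisj : Pairwise fun q r => Disjoint (R ∩ cell ⁻¹' {q}) (R ∩ cell ⁻¹' {r}) := by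
    intro q r hne
    rw [Set.disjoint_left]
    rintro z ⟨-, rfl⟩ ⟨-, h⟩
    exact hne h
  refine le_trans (measure_mono_ae ?_) (PP.measure_counts_mem_le hg hA hAb hdisj _)
  have hfin := ae_all_iff.2 fun q => PP.ae_count_ne_top hg (hA q) (hAb q)
  filter_upwards [hfin] with ω hω
  rintro ⟨C, hC, hch, hk⟩
  choose κ hκ using fun q => ENat.ne_top_iff_exists.1 (hω q)
  refine ⟨κ, ⟨C.image cell, ?_, hk.trans ?_⟩, fun q => (hκ q).symm⟩
  · rw [Finset.coe_image]
    rintro _ ⟨z, hz, rfl⟩ _ ⟨w, hw, rfl⟩ -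
    exact (hch.total hz hw).imp (fun h => hmono h) fun h => hmono h
  · rw [Finset.card_eq_sum_card_image cell C]
    refine Finset.sum_le_sum fun q _ => ?_
    have h1 : ((C.filter fun z => cell z = q : Finset (Fin d → ℝ)) : Set (Fin d → ℝ)).encard ≤
        (PP.pts ω ∩ (R ∩ cell ⁻¹' {q})).encard := by
      refine Set.encard_le_encard fun z hz => ?_
      rw [Finset.coe_filter, Set.mem_ofPred_eq] at hz
      exact ⟨(hC hz.1).1, (hC hz.1).2, hz.2⟩
    rw [Set.encard_coe_eq_coe_finsetCard, ← hκ q] at h1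
    exact_mod_cast h1

end CellCounts

section Grid

open ProbabilityTheory
open scoped NNReal ENNReal

variable {d : ℕ}

/-- The cell of the regular grid with `(m + 1) ^ d` cells on the unit cube containing a point. -/
def gridCell (d m : ℕ) (x : Fin d → ℝ) : Fin d → Fin (m + 1) := fun i =>
  ⟨min m ⌊(m + 1 : ℝ) * x i⌋₊, by omega⟩

lemma monotone_gridCell (m : ℕ) : Monotone (gridCell d m) := fun x y h i => by
  have : ⌊(m + 1 : ℝ) * x i⌋₊ ≤ ⌊(m + 1 : ℝ) * y i⌋₊ :=
    Nat.floor_mono (mul_le_mul_of_nonneg_left (h i) (by positivity))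
  simp only [gridCell, Fin.mk_le_mk]
  omega

lemma measurable_gridCell (m : ℕ) : Measurable (gridCell d m) := by
  refine measurable_pi_lambda _ fun i => ?_
  have h1 : Measurable fun x : Fin d → ℝ => ⌊(m + 1 : ℝ) * x i⌋₊ :=
    Nat.measurable_floor.comp (by fun_prop)
  exact (measurable_from_top (f := fun k : ℕ => (⟨min m k, by omega⟩ : Fin (m + 1)))).comp h1

lemma lt_add_of_gridCell_le {m : ℕ} {x y : Fin d → ℝ} (hx : x ≤ 1) (hy : 0 ≤ y)
    (h : gridCell d m x ≤ gridCell d m y) (i : Fin d) : x i ≤ y i + 2 / (m + 1) := by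
  have h1 := h i
  simp only [gridCell, Fin.mk_le_mk] at h1
  have hm : (0 : ℝ) < m + 1 := by positivity
  have h2 : (⌊(m + 1 : ℝ) * y i⌋₊ : ℝ) ≤ (m + 1) * y i :=
    Nat.floor_le (mul_nonneg hm.le (hy i))
  have h3 := Nat.lt_floor_add_one ((m + 1 : ℝ) * x i)
  have h4 : (m + 1 : ℝ) * x i ≤ (m + 1) * y i + 2 := by
    rcases le_total m ⌊(m + 1 : ℝ) * x i⌋₊ with hc | hc
    · have h5 : (m : ℝ) ≤ ⌊(m + 1 : ℝ) * y i⌋₊ := by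
        have : m ≤ ⌊(m + 1 : ℝ) * y i⌋₊ := by omega
        exact_mod_cast this
      have h6 : (m + 1 : ℝ) * x i ≤ m + 1 := by
        have := mul_le_mul_of_nonneg_left (hx i) hm.le
        simpa using this
      linarith
    · have h5 : (⌊(m + 1 : ℝ) * x i⌋₊ : ℝ) ≤ ⌊(m + 1 : ℝ) * y i⌋₊ := by
        have : ⌊(m + 1 : ℝ) * x i⌋₊ ≤ ⌊(m + 1 : ℝ) * y i⌋₊ := by omega
        exact_mod_cast this
      linarith
  rw [← sub_nonneg]
  have : y i + 2 / (m + 1) - x i = ((m + 1) * y i + 2 - (m + 1) * x i) / (m + 1) := by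
    field_simp
  rw [this]
  exact div_nonneg (by linarith) hm.le

lemma ae_mem_cube (N : ℕ) : ∀ᵐ X ∂(Measure.pi fun _ : Fin N => cubeMeasure d),
    ∀ j, X j ∈ Set.Icc (0 : Fin d → ℝ) 1 :=
  ae_all_iff.2 fun j => (Measure.quasiMeasurePreserving_eval _ j).ae
    (ae_restrict_mem measurableSet_Icc)

/-- Along refining grids the chains of cells reduce to chains of points. -/
lemma exists_tendsto_measure_gridCell_le (N k : ℕ) :
    ∃ u : ℕ → ℝ≥0∞, Tendsto u atTop (𝓝 0) ∧ ∀ m,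
      Measure.pi (fun _ : Fin N => cubeMeasure d)
          {X | k ≤ chainCount Finset.univ (gridCell d m ∘ X)} ≤
        Measure.pi (fun _ : Fin N => cubeMeasure d) {X | k ≤ chainCount Finset.univ X} + u m := by
  set B : ℕ → Set (Fin N → Fin d → ℝ) := fun m =>
    {X | ∃ i j j', X j' i < X j i ∧ X j i ≤ X j' i + 2 / (m + 1)} with hB
  have hBm : ∀ m, MeasurableSet (B m) := fun m => by
    have : B m = ⋃ i, ⋃ j, ⋃ j', {X | X j' i < X j i} ∩
        {X | X j i ≤ X j' i + 2 / ((m : ℝ) + 1)} := by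
      ext X; simp [hB]
    rw [this]
    refine MeasurableSet.iUnion fun i => MeasurableSet.iUnion fun j => MeasurableSet.iUnion
      fun j' => (measurableSet_lt (by fun_prop) (by fun_prop)).inter
        (measurableSet_le (by fun_prop) (by fun_prop))
  refine ⟨fun m => Measure.pi (fun _ : Fin N => cubeMeasure d) (B m), ?_, fun m => ?_⟩
  · have hanti : Antitone B := by
      rintro m m' h X ⟨i, j, j', h1, h2⟩
      refine ⟨i, j, j', h1, h2.trans ?_⟩
      gcongr
    have hempty : ⋂ m, B m = ∅ := by
      rw [Set.eq_empty_iff_forall_notMem]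
      intro X hX
      have hev : ∀ᶠ m : ℕ in atTop, ∀ i : Fin d, ∀ j j' : Fin N, X j' i < X j i →
          X j' i + 2 / ((m : ℝ) + 1) < X j i := by
        simp only [eventually_all]
        intro i j j' hlt
        have hlim : Tendsto (fun m : ℕ => X j' i + 2 / ((m : ℝ) + 1)) atTop (𝓝 (X j' i + 0)) :=
          tendsto_const_nhds.add
            (tendsto_const_nhds.div_atTop (tendsto_natCast_atTop_atTop.atTop_add
              tendsto_const_nhds))
        rw [add_zero] at hlim
        exact hlim.eventually_lt_const hlt
      obtain ⟨m, hm⟩ := hev.exists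
      obtain ⟨i, j, j', h1, h2⟩ := Set.mem_iInter.1 hX m
      exact absurd (hm i j j' h1) (not_lt.2 h2)
    have := tendsto_measure_iInter_atTop (μ := Measure.pi fun _ : Fin N => cubeMeasure d)
      (fun m => (hBm m).nullMeasurableSet) hanti ⟨0, measure_ne_top _ _⟩
    rwa [hempty, measure_empty] at this
  · refine le_trans (measure_mono_ae ?_) (measure_union_le _ _)
    filter_upwards [ae_mem_cube N] with X hX hk
    by_cases hXB : X ∈ B m
    · exact Or.inr hXB
    · refine Or.inl ?_
      have hle : ∀ j j', gridCell d m (X j) ≤ gridCell d m (X j') → X j ≤ X j' := by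
        intro j j' hc i
        by_contra hlt
        exact hXB ⟨i, j, j', not_le.1 hlt, lt_add_of_gridCell_le (hX j).2 (hX j').1 hc i⟩
      obtain ⟨S, hS, hc, hcard⟩ := exists_indexChain_card_eq Finset.univ (gridCell d m ∘ X)
      have hk' : k ≤ chainCount Finset.univ (gridCell d m ∘ X) := hk
      rw [← hcard] at hk'
      exact hk'.trans (le_chainCount hS fun i hi j hj =>
        (hc i hi j hj).imp (hle i j) (hle j i))

lemma measurableSet_le_chainCount_comp {ι : Type*} [Finite ι] [LE ι] [MeasurableSpace ι]
    [MeasurableSingletonClass ι] {α : Type*} [MeasurableSpace α] {cell : α → ι}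
    (hcell : Measurable cell) (N k : ℕ) :
    MeasurableSet {X : Fin N → α | k ≤ chainCount Finset.univ (cell ∘ X)} := by
  have h1 : Measurable fun X : Fin N → α => cell ∘ X :=
    measurable_pi_lambda _ fun j => hcell.comp (measurable_pi_apply j)
  exact h1 (Set.toFinite {Y : Fin N → ι | k ≤ chainCount Finset.univ Y}).measurableSet

lemma chainCount_tail_le {E : Type*} [LE E] {N : ℕ} (X : Fin (N + 1) → E) :
    chainCount Finset.univ (fun j : Fin N => X j.succ) ≤ chainCount Finset.univ X := by
  obtain ⟨S, -, hc, hcard⟩ := exists_indexChain_card_eq Finset.univ fun j : Fin N => X j.succ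
  rw [← hcard, ← Finset.card_map (Fin.succEmb N)]
  refine le_chainCount (Finset.subset_univ _) fun i hi j hj => ?_
  obtain ⟨i', hi', rfl⟩ := Finset.mem_map.1 hi
  obtain ⟨j', hj', rfl⟩ := Finset.mem_map.1 hj
  exact hc i' hi' j' hj'

lemma measure_chainCount_comp_mono {ι : Type*} [Finite ι] [LE ι] [MeasurableSpace ι]
    [MeasurableSingletonClass ι] {α : Type*} [MeasurableSpace α] (ν : Measure α)
    [IsProbabilityMeasure ν] {cell : α → ι} (hcell : Measurable cell) (k : ℕ) :
    Monotone fun N : ℕ => Measure.pi (fun _ : Fin N => ν)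
      {X | k ≤ chainCount Finset.univ (cell ∘ X)} := by
  refine monotone_nat_of_le_succ fun N => ?_
  have h1 := measurePreserving_piFinSuccAbove (fun _ : Fin (N + 1) => ν) 0
  have h2 : MeasurePreserving (Prod.snd : α × (Fin N → α) → Fin N → α)
      (ν.prod (Measure.pi fun _ : Fin N => ν)) (Measure.pi fun _ : Fin N => ν) :=
    measurePreserving_snd
  have h3 := h2.comp h1
  rw [← h3.measure_preimage
    (measurableSet_le_chainCount_comp hcell N k).nullMeasurableSet]
  refine measure_mono fun X hX => ?_
  exact le_trans hX (chainCount_tail_le (cell ∘ X))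

end Grid

section Domination

open ProbabilityTheory
open scoped NNReal ENNReal

variable {d : ℕ}

/-- The affine map sending the box `[a, b]` onto the unit cube. -/
def boxMap (a b x : Fin d → ℝ) : Fin d → ℝ := fun i => (x i - a i) / (b i - a i)

lemma volume_preimage_boxMap {a b : Fin d → ℝ} (hab : ∀ i, a i < b i) (s : Set (Fin d → ℝ)) :
    volume (boxMap a b ⁻¹' s) = ENNReal.ofReal (∏ i, (b i - a i)) * volume s := by
  have hdet : LinearMap.det (Matrix.toLin' (Matrix.diagonal fun i => (b i - a i)⁻¹)) =
      (∏ i, (b i - a i))⁻¹ := by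
    rw [LinearMap.det_toLin', Matrix.det_diagonal, Finset.prod_inv_distrib]
  have hpos : 0 < ∏ i, (b i - a i) := Finset.prod_pos fun i _ => sub_pos.2 (hab i)
  have hpre : boxMap a b ⁻¹' s = (fun x => x + -a) ⁻¹'
      (Matrix.toLin' (Matrix.diagonal fun i => (b i - a i)⁻¹) ⁻¹' s) := by
    ext x
    simp only [Set.mem_preimage]
    congr! 1
    ext i
    simp [boxMap, Matrix.mulVec_diagonal, div_eq_inv_mul, sub_eq_add_neg]
  rw [hpre, measure_preimage_add_right, Measure.addHaar_preimage_linearMap _ (by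
    rw [hdet]; exact (inv_pos.2 hpos).ne'), hdet, inv_inv, abs_of_pos hpos]

lemma boxMap_mono {a b : Fin d → ℝ} (hab : ∀ i, a i < b i) : Monotone (boxMap a b) :=
  fun _ _ h i => div_le_div_of_nonneg_right (sub_le_sub_right (h i) _) (sub_pos.2 (hab i)).le

lemma measurable_boxMap (a b : Fin d → ℝ) : Measurable (boxMap a b) := by
  unfold boxMap; fun_prop

lemma Icc_eq_preimage_boxMap {a b : Fin d → ℝ} (hab : ∀ i, a i < b i) :
    Set.Icc a b = boxMap a b ⁻¹' Set.Icc 0 1 := by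
  ext x
  simp only [Set.mem_preimage, Set.mem_Icc, Pi.le_def, boxMap, Pi.zero_apply, Pi.one_apply]
  refine and_congr (forall_congr' fun i => ?_) (forall_congr' fun i => ?_)
  · rw [le_div_iff₀ (sub_pos.2 (hab i)), zero_mul, sub_nonneg]
  · rw [div_le_one (sub_pos.2 (hab i)), sub_le_sub_iff_right]

variable {Ω : Type*} [MeasurableSpace Ω] {P : Measure Ω} [IsProbabilityMeasure P]
  {g : (Fin d → ℝ) → ℝ}

/-- A Poisson process with intensity at most `L` on a box has chains no longer than those of
uniform points, up to the tail of a Poisson variable. -/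
theorem PoissonPP.measure_exists_chain_box_le (PP : PoissonPP d P g) (hg : ∀ x, 0 ≤ g x)
    {a b : Fin d → ℝ} (hab : ∀ i, a i < b i) {L : ℝ} (hL : ∀ x ∈ Set.Icc a b, g x ≤ L)
    (N k : ℕ) :
    P {ω | ∃ C : Finset (Fin d → ℝ), ↑C ⊆ PP.pts ω ∩ Set.Icc a b ∧
        IsChain (· ≤ ·) (C : Set (Fin d → ℝ)) ∧ k ≤ C.card} ≤
      poissonMeasure (L * ∏ i, (b i - a i)).toNNReal (Set.Ioi N) +
        Measure.pi (fun _ : Fin N => cubeMeasure d) {X | k ≤ chainCount Finset.univ X} := by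
  set μ : ℝ≥0 := (L * ∏ i, (b i - a i)).toNNReal with hμ
  have hL0 : 0 ≤ L := (hg a).trans (hL a ⟨le_rfl, fun i => (hab i).le⟩)
  have hvol : 0 ≤ ∏ i, (b i - a i) := Finset.prod_nonneg fun i _ => (sub_pos.2 (hab i)).le
  obtain ⟨u, hu, hle⟩ := exists_tendsto_measure_gridCell_le (d := d) N k
  have key : ∀ m, P {ω | ∃ C : Finset (Fin d → ℝ), ↑C ⊆ PP.pts ω ∩ Set.Icc a b ∧
      IsChain (· ≤ ·) (C : Set (Fin d → ℝ)) ∧ k ≤ C.card} ≤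
        poissonMeasure μ (Set.Ioi N) +
          Measure.pi (fun _ : Fin N => cubeMeasure d) {X | k ≤ chainCount Finset.univ X} +
            u m := by
    intro m
    set p : (Fin d → Fin (m + 1)) → ℝ≥0 := fun q =>
      (cubeMeasure d (gridCell d m ⁻¹' {q})).toNNReal
    have hp : ∀ q, cubeMeasure d (gridCell d m ⁻¹' {q}) = p q := fun q =>
      (ENNReal.coe_toNNReal (measure_ne_top _ _)).symm
    have hrate : ∀ q, (∫ x in Set.Icc a b ∩ (gridCell d m ∘ boxMap a b) ⁻¹' {q}, g x).toNNReal ≤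
        μ * p q := by
      intro q
      have hv : volume (Set.Icc a b ∩ (gridCell d m ∘ boxMap a b) ⁻¹' {q}) =
          ENNReal.ofReal (∏ i, (b i - a i)) * p q := by
        rw [← hp, Icc_eq_preimage_boxMap hab, Set.preimage_comp, ← Set.preimage_inter,
          volume_preimage_boxMap hab, Measure.restrict_apply
            (measurable_gridCell m (measurableSet_singleton q)), Set.inter_comm]
      have hlt : volume (Set.Icc a b ∩ (gridCell d m ∘ boxMap a b) ⁻¹' {q}) < ⊤ := by
        rw [hv]; exact ENNReal.mul_lt_top ENNReal.ofReal_lt_top ENNReal.coe_lt_top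
      have hn := norm_setIntegral_le_of_norm_le_const (f := g) (C := L) hlt fun x hx => by
        rw [Real.norm_of_nonneg (hg x)]; exact hL x hx.1
      rw [Measure.real, hv, ENNReal.toReal_mul, ENNReal.toReal_ofReal hvol,
        ENNReal.coe_toReal] at hn
      rw [Real.toNNReal_le_iff_le_coe, NNReal.coe_mul, hμ,
        Real.coe_toNNReal _ (mul_nonneg hL0 hvol), mul_assoc]
      exact (le_abs_self _).trans hn
    refine (PP.measure_exists_chain_le hg measurableSet_Icc (Metric.isBounded_Icc a b)
      ((measurable_gridCell m).comp (measurable_boxMap a b))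
      ((monotone_gridCell m).comp (boxMap_mono hab)) k).trans ?_
    refine (pi_poissonMeasure_mono hrate (isUpperSet_chainOccupancies _ k)).trans ?_
    rw [pi_poissonMeasure_eq_tsum (cubeMeasure d) (measurable_gridCell m) μ hp]
    set Q : ℕ → ℝ≥0∞ := fun M => Measure.pi (fun _ : Fin M => cubeMeasure d)
      {X | k ≤ chainCount Finset.univ (gridCell d m ∘ X)}
    have hQ : Monotone Q := measure_chainCount_comp_mono (cubeMeasure d) (measurable_gridCell m) k
    have hterm : ∀ M, poissonMeasure μ {M} * Measure.pi (fun _ : Fin M => cubeMeasure d)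
        {X | occupancy (gridCell d m ∘ X) ∈ chainOccupancies _ k} ≤
          (Set.Ioi N).indicator (fun M => poissonMeasure μ {M}) M +
            poissonMeasure μ {M} * Q N := by
      intro M
      have h1 : Measure.pi (fun _ : Fin M => cubeMeasure d)
          {X | occupancy (gridCell d m ∘ X) ∈ chainOccupancies _ k} ≤ Q M :=
        measure_mono fun X hX => le_chainCount_of_occupancy_mem hX
      rcases lt_or_ge N M with h | h
      · rw [Set.indicator_of_mem (show M ∈ Set.Ioi N from h)]
        refine le_add_right ((mul_le_mul_right (h1.trans prob_le_one) _).trans ?_)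
        rw [mul_one]
      · exact le_add_left (mul_le_mul_right (h1.trans (hQ h)) _)
    refine (ENNReal.tsum_le_tsum hterm).trans ?_
    rw [ENNReal.tsum_add, ENNReal.tsum_mul_right, Measure.tsum_indicator_apply_singleton _ _
      (Set.to_countable _).measurableSet, add_assoc]
    have hone : ∑' M, poissonMeasure μ {M} = 1 := by
      simpa using Measure.tsum_indicator_apply_singleton (poissonMeasure μ) Set.univ
        MeasurableSet.univ
    rw [hone, one_mul]
    exact add_le_add_right (hle m) _
  have hlim := (tendsto_const_nhds (x := poissonMeasure μ (Set.Ioi N) +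
    Measure.pi (fun _ : Fin N => cubeMeasure d) {X | k ≤ chainCount Finset.univ X})).add hu
  rw [add_zero] at hlim
  exact ge_of_tendsto' hlim key

end Domination

section Tails

open ProbabilityTheory
open scoped NNReal ENNReal

/-- Chernoff bound for the Poisson distribution. -/
lemma poissonMeasure_Ioi_le (μ : ℝ≥0) {δ : ℝ} (hδ : 0 < δ) {N : ℕ}
    (hN : (1 + δ) ^ 2 * μ ≤ N) :
    poissonMeasure μ (Set.Ioi N) ≤ ENNReal.ofReal (Real.exp (-(δ ^ 2 * μ))) := by
  have hterm : ∀ M, (Set.Ioi N).indicator (fun M => poissonMeasure μ {M}) M ≤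
      ENNReal.ofReal (Real.exp (-(δ ^ 2 * μ))) *
        poissonMeasure (μ * (1 + δ).toNNReal) {M} := by
    intro M
    by_cases hM : M ∈ Set.Ioi N
    · rw [Set.indicator_of_mem hM, poissonMeasure_singleton, poissonMeasure_singleton,
        ← ENNReal.ofReal_mul (Real.exp_nonneg _)]
      refine ENNReal.ofReal_le_ofReal ?_
      rw [NNReal.coe_mul, Real.coe_toNNReal _ (by linarith), mul_pow]
      have h1 : Real.exp (δ / (1 + δ)) ≤ 1 + δ := by
        rw [← Real.le_log_iff_exp_le (by linarith)]
        refine le_trans (le_of_eq ?_) (Real.one_sub_inv_le_log_of_pos (by linarith))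
        field_simp
        ring
      have h2 : Real.exp (δ * (1 + δ) * μ) ≤ (1 + δ) ^ M := by
        calc Real.exp (δ * (1 + δ) * μ) ≤ Real.exp (M * (δ / (1 + δ))) := by
              refine Real.exp_le_exp.2 ?_
              have : (N : ℝ) ≤ M := by exact_mod_cast (le_of_lt hM)
              calc δ * (1 + δ) * μ = ((1 + δ) ^ 2 * μ) * (δ / (1 + δ)) := by field_simp
                _ ≤ M * (δ / (1 + δ)) := by gcongr; linarith
          _ = Real.exp (δ / (1 + δ)) ^ M := Real.exp_nat_mul _ _
          _ ≤ (1 + δ) ^ M := by gcongr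
      have h3 : Real.exp (-(μ : ℝ)) = Real.exp (-(δ ^ 2 * μ)) * Real.exp (-(μ * (1 + δ))) *
          Real.exp (δ * (1 + δ) * μ) := by
        rw [← Real.exp_add, ← Real.exp_add]; congr 1; ring
      rw [h3]
      calc Real.exp (-(δ ^ 2 * μ)) * Real.exp (-(μ * (1 + δ))) * Real.exp (δ * (1 + δ) * μ) *
            (μ : ℝ) ^ M / M.factorial ≤
          Real.exp (-(δ ^ 2 * μ)) * Real.exp (-(μ * (1 + δ))) * (1 + δ) ^ M *
            (μ : ℝ) ^ M / M.factorial := by gcongr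
        _ = _ := by ring
    · rw [Set.indicator_of_notMem hM]; exact zero_le
  rw [← Measure.tsum_indicator_apply_singleton _ _ (Set.to_countable _).measurableSet]
  refine (ENNReal.tsum_le_tsum hterm).trans ?_
  have hone : ∑' M, poissonMeasure (μ * (1 + δ).toNNReal) {M} = 1 := by
    simpa using Measure.tsum_indicator_apply_singleton (poissonMeasure (μ * (1 + δ).toNNReal))
      Set.univ MeasurableSet.univ
  rw [ENNReal.tsum_mul_left, hone, mul_one]

lemma summable_exp_neg_mul_rpow {C s : ℝ} (hC : 0 < C) (hs : 0 < s) :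
    Summable fun n : ℕ => Real.exp (-C * (n : ℝ) ^ s) := by
  have h1 := (isLittleO_exp_neg_mul_rpow_atTop hC (-2 / s)).comp_tendsto
    ((tendsto_rpow_atTop hs).comp tendsto_natCast_atTop_atTop)
  have h2 : Summable fun n : ℕ => (n : ℝ) ^ (-2 : ℝ) := Real.summable_nat_rpow.2 (by norm_num)
  refine summable_of_isBigO_nat h2 (h1.isBigO.congr_right fun n => ?_)
  simp only [Function.comp_apply]
  rw [← Real.rpow_mul (Nat.cast_nonneg n), mul_div_cancel₀ _ hs.ne']

lemma ae_eventually_notMem_of_le {Ω : Type*} [MeasurableSpace Ω] {P : Measure Ω}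
    {s : ℕ → Set Ω} {v : ℕ → ℝ} (hv : Summable v)
    (h : ∀ᶠ n in atTop, P (s n) ≤ ENNReal.ofReal (v n)) :
    ∀ᵐ ω ∂P, ∀ᶠ n in atTop, ω ∉ s n := by
  obtain ⟨n₀, hn₀⟩ := eventually_atTop.1 h
  have hsum : ∑' n, P (s (n + n₀)) ≠ ⊤ := by
    refine ne_top_of_le_ne_top ((summable_nat_add_iff n₀).2 hv).tsum_ofReal_ne_top
      (ENNReal.tsum_le_tsum fun n => hn₀ _ (Nat.le_add_left _ _))
  filter_upwards [ae_eventually_notMem hsum] with ω hω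
  obtain ⟨n₁, hn₁⟩ := eventually_atTop.1 hω
  refine eventually_atTop.2 ⟨n₁ + n₀, fun n hn => ?_⟩
  have := hn₁ (n - n₀) (by omega)
  rwa [Nat.sub_add_cancel (by omega)] at this

end Tails

section AlmostSure

open ProbabilityTheory
open scoped NNReal ENNReal

variable {d : ℕ} {c : ℝ}

/-- A sample size slightly above `μ₀ n` whose expected longest chain stays controlled. -/
lemma exists_eventually_BWexpect_le (hd : 0 < d) (hc : IsBWConstant d c) {μ₀ ε : ℝ} (hμ : 0 < μ₀)
    (hε : 0 < ε) :
    ∃ δ > 0, ∀ᶠ n : ℕ in atTop,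
      BWexpect d ⌈(1 + δ) ^ 2 * (μ₀ * n)⌉₊ + ε / 2 * (n : ℝ) ^ (1 / d : ℝ) ≤
      (c * μ₀ ^ (1 / d : ℝ) + ε) * (n : ℝ) ^ (1 / d : ℝ) := by
  have hs : (0 : ℝ) < 1 / d := by positivity
  have hcont : ContinuousAt (fun δ : ℝ => (c + δ) * ((1 + δ) ^ 3 * μ₀) ^ (1 / d : ℝ)) 0 := by
    refine ContinuousAt.mul (by fun_prop) (ContinuousAt.rpow_const (by fun_prop) ?_)
    left; simp [hμ.ne']
  have hlt : ∀ᶠ δ in 𝓝[>] (0 : ℝ), (c + δ) * ((1 + δ) ^ 3 * μ₀) ^ (1 / d : ℝ) <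
      c * μ₀ ^ (1 / d : ℝ) + ε / 2 := by
    refine (hcont.tendsto.mono_left nhdsWithin_le_nhds).eventually_lt_const ?_
    simp [hε]
  obtain ⟨δ, hδlt, hδ⟩ := (hlt.and self_mem_nhdsWithin).exists
  have hδ : 0 < δ := hδ
  refine ⟨δ, hδ, ?_⟩
  have hN : Tendsto (fun n : ℕ => ⌈(1 + δ) ^ 2 * (μ₀ * n)⌉₊) atTop atTop := by
    refine tendsto_nat_ceil_atTop.comp ?_
    exact (tendsto_natCast_atTop_atTop.const_mul_atTop hμ).const_mul_atTop (by positivity)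
  have hBW : ∀ᶠ N : ℕ in atTop, BWexpect d N ≤ (c + δ) * (N : ℝ) ^ (1 / d : ℝ) := by
    filter_upwards [hc.2.eventually_lt_const (show c < c + δ by linarith), eventually_gt_atTop 0]
      with N h h0
    have hN0 : (0 : ℝ) < N := by exact_mod_cast h0
    rw [neg_div, Real.rpow_neg hN0.le, inv_mul_lt_iff₀ (by positivity), mul_comm] at h
    exact h.le
  have hlarge : ∀ᶠ n : ℕ in atTop, 1 ≤ δ * (1 + δ) ^ 2 * μ₀ * (n : ℝ) :=
    (tendsto_natCast_atTop_atTop.const_mul_atTop (by positivity)).eventually_ge_atTop 1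
  filter_upwards [hN.eventually hBW, hlarge] with n h1 h2
  have h3 : (⌈(1 + δ) ^ 2 * (μ₀ * n)⌉₊ : ℝ) ≤ (1 + δ) ^ 3 * μ₀ * n := by
    refine (Nat.ceil_lt_add_one (by positivity)).le.trans ?_
    nlinarith
  have h4 : (⌈(1 + δ) ^ 2 * (μ₀ * n)⌉₊ : ℝ) ^ (1 / d : ℝ) ≤
      ((1 + δ) ^ 3 * μ₀) ^ (1 / d : ℝ) * (n : ℝ) ^ (1 / d : ℝ) := by
    rw [← Real.mul_rpow (by positivity) (by positivity)]
    exact Real.rpow_le_rpow (by positivity) h3 hs.le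
  have h5 : (0 : ℝ) ≤ (n : ℝ) ^ (1 / d : ℝ) := by positivity
  have hc0 := hc.1
  calc BWexpect d ⌈(1 + δ) ^ 2 * (μ₀ * n)⌉₊ + ε / 2 * (n : ℝ) ^ (1 / d : ℝ)
      ≤ (c + δ) * (((1 + δ) ^ 3 * μ₀) ^ (1 / d : ℝ) * (n : ℝ) ^ (1 / d : ℝ)) +
        ε / 2 * (n : ℝ) ^ (1 / d : ℝ) := by
        gcongr
        exact h1.trans (by gcongr)
    _ = ((c + δ) * ((1 + δ) ^ 3 * μ₀) ^ (1 / d : ℝ) + ε / 2) * (n : ℝ) ^ (1 / d : ℝ) := by ring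
    _ ≤ _ := mul_le_mul_of_nonneg_right (by linarith) h5

variable {Ω : Type*} [MeasurableSpace Ω] {P : Measure Ω} [IsProbabilityMeasure P]
  {f : (Fin d → ℝ) → ℝ}

/-- Almost surely, the chains in a fixed box are eventually not much longer than expected. -/
theorem ae_eventually_chain_card_le (hd : 0 < d) (hc : IsBWConstant d c) (hf : ∀ x, 0 ≤ f x)
    (PP : ∀ n : ℕ, PoissonPP d P fun z => (n : ℝ) * f z) {a b : Fin d → ℝ}
    (hab : ∀ i, a i < b i) {L : ℝ} (hL0 : 0 < L) (hL : ∀ x ∈ Set.Icc a b, f x ≤ L) {ε : ℝ}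
    (hε : 0 < ε) :
    ∀ᵐ ω ∂P, ∀ᶠ n : ℕ in atTop, ∀ C : Finset (Fin d → ℝ), ↑C ⊆ (PP n).pts ω ∩ Set.Icc a b →
      IsChain (· ≤ ·) (C : Set (Fin d → ℝ)) →
      (C.card : ℝ) ≤ (c * (L * ∏ i, (b i - a i)) ^ (1 / d : ℝ) + ε) * (n : ℝ) ^ (1 / d : ℝ) := by
  have hμ : 0 < L * ∏ i, (b i - a i) :=
    mul_pos hL0 (Finset.prod_pos fun i _ => sub_pos.2 (hab i))
  set μ₀ := L * ∏ i, (b i - a i) with hμ₀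
  obtain ⟨δ, hδ, hBW⟩ := exists_eventually_BWexpect_le hd hc hμ hε
  set K := c * μ₀ ^ (1 / d : ℝ) + ε with hK
  have hc0 := hc.1
  have hK0 : 0 < K := by positivity
  have hs : (0 : ℝ) < 1 / d := by positivity
  have hsum1 : Summable fun n : ℕ => Real.exp (-(δ ^ 2 * μ₀) * (n : ℝ) ^ (1 : ℝ)) :=
    summable_exp_neg_mul_rpow (by positivity) one_pos
  have hsum2 : Summable fun n : ℕ =>
      Real.exp 3 * Real.exp (-(ε / 2 / √K) * (n : ℝ) ^ (1 / d / 2 : ℝ)) :=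
    (summable_exp_neg_mul_rpow (by positivity) (by positivity)).mul_left _
  have hbad : ∀ᶠ n : ℕ in atTop, P {ω | ∃ C : Finset (Fin d → ℝ),
      ↑C ⊆ (PP n).pts ω ∩ Set.Icc a b ∧ IsChain (· ≤ ·) (C : Set (Fin d → ℝ)) ∧
        ⌈K * (n : ℝ) ^ (1 / d : ℝ)⌉₊ ≤ C.card} ≤
      ENNReal.ofReal (Real.exp (-(δ ^ 2 * μ₀) * (n : ℝ) ^ (1 : ℝ)) +
        Real.exp 3 * Real.exp (-(ε / 2 / √K) * (n : ℝ) ^ (1 / d / 2 : ℝ))) := by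
    filter_upwards [hBW, eventually_gt_atTop 0] with n hn hn0
    have hnpos : (0 : ℝ) < n := by exact_mod_cast hn0
    rw [ENNReal.ofReal_add (by positivity) (by positivity)]
    refine ((PP n).measure_exists_chain_box_le (fun x => mul_nonneg hnpos.le (hf x)) hab
      (L := n * L) (fun x hx => mul_le_mul_of_nonneg_left (hL x hx) hnpos.le)
      ⌈(1 + δ) ^ 2 * (μ₀ * n)⌉₊ ⌈K * (n : ℝ) ^ (1 / d : ℝ)⌉₊).trans ?_
    have hrate : ((n * L * ∏ i, (b i - a i)).toNNReal : ℝ) = μ₀ * n := by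
      rw [mul_assoc, ← hμ₀, Real.coe_toNNReal _ (by positivity), mul_comm]
    refine add_le_add ?_ ?_
    · refine (poissonMeasure_Ioi_le _ hδ ?_).trans (le_of_eq ?_)
      · rw [hrate]; exact Nat.le_ceil _
      · rw [hrate, Real.rpow_one]; ring_nf
    · have hB : 0 < K * (n : ℝ) ^ (1 / d : ℝ) := by positivity
      have h1 := measure_chainCount_ge_le hd ⌈(1 + δ) ^ 2 * (μ₀ * n)⌉₊ hB hn
      rw [← ofReal_measureReal]
      refine ENNReal.ofReal_le_ofReal (le_trans ?_ (h1.trans (le_of_eq ?_)))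
      · exact measureReal_mono fun X hX => (Nat.le_ceil _).trans (Nat.cast_le.2 hX)
      · rw [← Real.exp_add]
        congr 1
        have h2 : √((n : ℝ) ^ (1 / d : ℝ)) = (n : ℝ) ^ (1 / d / 2 : ℝ) := by
          rw [Real.sqrt_eq_rpow, ← Real.rpow_mul hnpos.le]; congr 1; ring
        have h3 : (n : ℝ) ^ (1 / d : ℝ) = (n : ℝ) ^ (1 / d / 2 : ℝ) * (n : ℝ) ^ (1 / d / 2 : ℝ) := by
          rw [← h2, Real.mul_self_sqrt (by positivity)]
        rw [Real.sqrt_mul hK0.le, h2, h3]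
        have h4 : 0 < (n : ℝ) ^ (1 / d / 2 : ℝ) := by positivity
        have h5 : 0 < √K := Real.sqrt_pos.2 hK0
        field_simp
        ring
  filter_upwards [ae_eventually_notMem_of_le (hsum1.add hsum2) hbad] with ω hω
  filter_upwards [hω] with n hn C hC hch
  by_contra hlt
  exact hn ⟨C, hC, hch, Nat.ceil_le.2 (not_le.1 hlt).le⟩

end AlmostSure

section ChainLength

variable {d : ℕ}

lemma card_le_chainLength {A : Set (Fin d → ℝ)} {B : ℕ}
    (hB : ∀ C : Finset (Fin d → ℝ), ↑C ⊆ A → IsChain (· ≤ ·) (C : Set (Fin d → ℝ)) → C.card ≤ B)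
    {C : Finset (Fin d → ℝ)} (hC : ↑C ⊆ A) (hch : IsChain (· ≤ ·) (C : Set (Fin d → ℝ))) :
    C.card ≤ chainLength d A := by
  refine le_csSup ⟨B, ?_⟩ ⟨C, hC, hch, rfl⟩
  rintro _ ⟨C', hC', hch', rfl⟩
  exact hB C' hC' hch'

lemma exists_card_eq_chainLength {A : Set (Fin d → ℝ)} {B : ℕ}
    (hB : ∀ C : Finset (Fin d → ℝ), ↑C ⊆ A → IsChain (· ≤ ·) (C : Set (Fin d → ℝ)) →
      C.card ≤ B) :
    ∃ C : Finset (Fin d → ℝ), ↑C ⊆ A ∧ IsChain (· ≤ ·) (C : Set (Fin d → ℝ)) ∧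
      C.card = chainLength d A := by
  refine Nat.sSup_mem (s := {n : ℕ | ∃ C : Finset (Fin d → ℝ),
    ↑C ⊆ A ∧ IsChain (· ≤ ·) (C : Set (Fin d → ℝ)) ∧ C.card = n}) ⟨0, ∅, by simp⟩ ⟨B, ?_⟩
  rintro _ ⟨C', hC', hch', rfl⟩
  exact hB C' hC' hch'

end ChainLength

section Envelope

variable {d : ℕ} {f : (Fin d → ℝ) → ℝ}

lemma MemB.isBoundedUnder (hf : MemB d f) (x : Fin d → ℝ) :
    IsBoundedUnder (· ≤ ·) (𝓝 x) f := by
  obtain ⟨U, hU, B, hB⟩ := hf.2.2 x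
  exact ⟨B, eventually_map.2 (mem_of_superset hU fun z hz => hB (Set.mem_image_of_mem f hz))⟩

lemma MemB.exists_le_of_isCompact (hf : MemB d f) {K : Set (Fin d → ℝ)} (hK : IsCompact K) :
    ∃ B, ∀ x ∈ K, f x ≤ B := by
  refine hK.induction_on (p := fun s => ∃ B, ∀ x ∈ s, f x ≤ B) ⟨0, by simp⟩ ?_ ?_ ?_
  · rintro s t hst ⟨B, hB⟩
    exact ⟨B, fun x hx => hB x (hst hx)⟩
  · rintro s t ⟨B, hB⟩ ⟨B', hB'⟩
    exact ⟨max B B', fun x hx => hx.elim (fun h => (hB x h).trans (le_max_left _ _))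
      fun h => (hB' x h).trans (le_max_right _ _)⟩
  · intro x _
    obtain ⟨U, hU, B, hB⟩ := hf.2.2 x
    exact ⟨U, mem_nhdsWithin_of_mem_nhds hU, B, fun z hz => hB (Set.mem_image_of_mem f hz)⟩

lemma MemB.upperEnv_nonneg (hf : MemB d f) (x : Fin d → ℝ) : 0 ≤ upperEnv d f x :=
  le_limsup_of_frequently_le (Eventually.of_forall hf.2.1).frequently (hf.isBoundedUnder x)

lemma MemB.bddAbove_upperEnv (hf : MemB d f) {K : Set (Fin d → ℝ)} (hK : IsCompact K) :
    BddAbove (upperEnv d f '' K) := by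
  refine hK.induction_on (p := fun s => BddAbove (upperEnv d f '' s)) (by simp) ?_ ?_ ?_
  · exact fun s t hst ht => ht.mono (Set.image_mono hst)
  · intro s t hs ht
    rw [Set.image_union]
    exact hs.union ht
  · intro x _
    obtain ⟨U, hU, B, hB⟩ := hf.2.2 x
    refine ⟨interior U, mem_nhdsWithin_of_mem_nhds (interior_mem_nhds.2 hU), B, ?_⟩
    rintro _ ⟨z, hz, rfl⟩
    refine limsup_le_of_le ?_ ?_
    · exact isCoboundedUnder_le_of_le (𝓝 z) (x := 0) hf.2.1
    · exact mem_of_superset (mem_interior_iff_mem_nhds.1 hz)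
        fun w hw => hB (Set.mem_image_of_mem f hw)

/-- Near a cube, `f` is at most slightly above the supremum of its upper envelope. -/
lemma MemB.exists_le_sSup_upperEnv_add (hf : MemB d f) {M : ℝ} (hM : 0 ≤ M) {η : ℝ} (hη : 0 < η) :
    ∃ δ > 0, δ ≤ η ∧ ∀ z : Fin d → ℝ, (∀ i, -δ ≤ z i ∧ z i ≤ M + δ) →
      f z ≤ sSup (upperEnv d f '' Set.Icc (0 : Fin d → ℝ) fun _ => M) + η := by
  set K := Set.Icc (0 : Fin d → ℝ) fun _ => M
  have hK : IsCompact K := isCompact_Icc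
  have hnhds : {z | f z < sSup (upperEnv d f '' K) + η} ∈ 𝓝ˢ K := by
    refine mem_nhdsSet_iff_forall.2 fun w hw => ?_
    have h1 : upperEnv d f w ≤ sSup (upperEnv d f '' K) :=
      le_csSup (hf.bddAbove_upperEnv hK) (Set.mem_image_of_mem _ hw)
    exact eventually_lt_of_limsup_lt (show upperEnv d f w < _ by linarith) (hf.isBoundedUnder w)
  obtain ⟨r, hr, hsub⟩ := (Metric.hasBasis_nhdsSet_thickening hK).mem_iff.1 hnhds
  refine ⟨min η (r / 2), by positivity, min_le_left _ _, fun z hz => ?_⟩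
  have hzr : ∀ i, -(r / 2) ≤ z i ∧ z i ≤ M + r / 2 := fun i =>
    ⟨(neg_le_neg (min_le_right η (r / 2))).trans (hz i).1,
      (hz i).2.trans (by gcongr; exact min_le_right _ _)⟩
  refine (hsub (Metric.mem_thickening_iff.2 ⟨fun i => max 0 (min M (z i)), ⟨?_, ?_⟩, ?_⟩)).le
  · exact fun i => le_max_left _ _
  · exact fun i => max_le hM (min_le_left _ _)
  · rw [dist_pi_lt_iff hr]
    intro i
    obtain ⟨h1, h2⟩ := hzr i
    rw [Real.dist_eq, abs_lt]
    rcases le_total M (z i) with h | h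
    · rw [min_eq_left h, max_eq_right hM]; constructor <;> linarith
    · rw [min_eq_right h]
      rcases le_total 0 (z i) with h0 | h0
      · rw [max_eq_right h0]; constructor <;> linarith
      · rw [max_eq_left h0]; constructor <;> linarith

end Envelope

section Deterministic

variable {d : ℕ} {c : ℝ} {f : (Fin d → ℝ) → ℝ} {X : ℕ → Set (Fin d → ℝ)}

/-- Chains of `X n` in rational boxes are asymptotically no longer than the Bollobás–Winkler
constant predicts. -/
def ChainBoundRat (d : ℕ) (c : ℝ) (f : (Fin d → ℝ) → ℝ) (X : ℕ → Set (Fin d → ℝ)) : Prop :=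
  ∀ (a b : Fin d → ℚ) (L ε : ℚ), (∀ i, (a i : ℝ) < b i) → (0 : ℝ) < L → (0 : ℝ) < ε →
    (∀ x ∈ Set.Icc (fun i => (a i : ℝ)) fun i => (b i : ℝ), f x ≤ L) →
    ∀ᶠ n : ℕ in atTop, ∀ C : Finset (Fin d → ℝ),
      ↑C ⊆ X n ∩ Set.Icc (fun i => (a i : ℝ)) (fun i => (b i : ℝ)) →
      IsChain (· ≤ ·) (C : Set (Fin d → ℝ)) →
      (C.card : ℝ) ≤ (c * (L * ∏ i, ((b i : ℝ) - a i)) ^ (1 / d : ℝ) + ε) * (n : ℝ) ^ (1 / d : ℝ)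

lemma ChainBoundRat.eventually_card_le (h : ChainBoundRat d c f X) (hc : 0 ≤ c)
    {a b : Fin d → ℝ} (hab : a ≤ b) {δ η Λ : ℝ} (hδ : 0 < δ) (hδη : δ ≤ η) (hΛ : 0 ≤ Λ)
    (hf : ∀ x, (∀ i, a i - δ ≤ x i ∧ x i ≤ b i + δ) → f x ≤ Λ) :
    ∀ᶠ n : ℕ in atTop, ∀ C : Finset (Fin d → ℝ), ↑C ⊆ X n ∩ Set.Icc a b →
      IsChain (· ≤ ·) (C : Set (Fin d → ℝ)) →
      (C.card : ℝ) ≤ (c * ((Λ + η) * ∏ i, (b i - a i + 2 * η)) ^ (1 / d : ℝ) + η) *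
        (n : ℝ) ^ (1 / d : ℝ) := by
  have hη : 0 < η := hδ.trans_le hδη
  choose a' ha1 ha2 using fun i => exists_rat_btwn (show a i - δ < a i by linarith)
  choose b' hb1 hb2 using fun i => exists_rat_btwn (show b i < b i + δ by linarith)
  obtain ⟨L, hL1, hL2⟩ := exists_rat_btwn (show Λ < Λ + η by linarith)
  obtain ⟨ε, hε1, hε2⟩ := exists_rat_btwn hη
  have hlt : ∀ i, (a' i : ℝ) < b' i := fun i => by linarith [ha2 i, hb1 i, hab i]
  filter_upwards [h a' b' L ε hlt (by linarith) hε1 fun x hx => (hf x fun i =>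
    ⟨(ha1 i).le.trans (hx.1 i), (hx.2 i).trans (hb2 i).le⟩).trans hL1.le] with n hn C hC hch
  have hsub : Set.Icc a b ⊆ Set.Icc (fun i => (a' i : ℝ)) fun i => (b' i : ℝ) :=
    Set.Icc_subset_Icc (fun i => (ha2 i).le) fun i => (hb1 i).le
  refine (hn C (hC.trans (Set.inter_subset_inter_right _ hsub)) hch).trans ?_
  have hprod : (L : ℝ) * ∏ i, ((b' i : ℝ) - a' i) ≤ (Λ + η) * ∏ i, (b i - a i + 2 * η) := by
    refine mul_le_mul hL2.le (Finset.prod_le_prod (fun i _ => by linarith [hlt i])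
      fun i _ => by linarith [ha1 i, hb2 i]) (Finset.prod_nonneg fun i _ => by linarith [hlt i])
      (by linarith)
  have hnn : 0 ≤ (L : ℝ) * ∏ i, ((b' i : ℝ) - a' i) :=
    mul_nonneg (by linarith) (Finset.prod_nonneg fun i _ => by linarith [hlt i])
  gcongr

lemma ChainBoundRat.eventually_bounded (h : ChainBoundRat d c f X) (hc : 0 ≤ c) (hf : MemB d f)
    {x : Fin d → ℝ} (hx : 0 ≤ x) :
    ∀ᶠ n : ℕ in atTop, ∃ B : ℕ, ∀ C : Finset (Fin d → ℝ), ↑C ⊆ X n ∩ Set.Icc 0 x →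
      IsChain (· ≤ ·) (C : Set (Fin d → ℝ)) → C.card ≤ B := by
  obtain ⟨Λ, hΛ⟩ := hf.exists_le_of_isCompact
    (isCompact_Icc (a := fun _ => (-1 : ℝ)) (b := fun i => x i + 1))
  have hΛ0 : 0 ≤ Λ := (hf.2.1 0).trans (hΛ 0
    ⟨fun i => by simp, fun i => by have := hx i; simp only [Pi.zero_apply] at *; linarith⟩)
  filter_upwards [h.eventually_card_le hc hx one_pos le_rfl hΛ0 fun z hz => hΛ z
    ⟨fun i => by simpa using (hz i).1, fun i => (hz i).2⟩] with n hn
  obtain ⟨B, hB⟩ := exists_nat_ge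
    ((c * ((Λ + 1) * ∏ i, (x i - (0 : Fin d → ℝ) i + 2 * 1)) ^ (1 / d : ℝ) + 1) *
      (n : ℝ) ^ (1 / d : ℝ))
  exact ⟨B, fun C hC hch => by exact_mod_cast (hn C hC hch).trans hB⟩

lemma sub_le_euclNorm (x y : Fin d → ℝ) (i : Fin d) : x i - y i ≤ euclNorm d (x - y) := by
  refine (le_abs_self _).trans (Real.abs_le_sqrt ?_)
  exact Finset.single_le_sum (f := fun i => ((x - y) i) ^ 2) (fun _ _ => sq_nonneg _)
    (Finset.mem_univ i)

lemma ChainBoundRat.eventually_sub_le (h : ChainBoundRat d c f X) (hd : 0 < d) (hc : 0 ≤ c)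
    (hf : MemB d f) {x y : Fin d → ℝ} (hx : 0 ≤ x) (hy : 0 ≤ y) {M : ℝ} (hxM : ∀ i, x i ≤ M)
    {η : ℝ} (hη : 0 < η) :
    ∀ᶠ n : ℕ in atTop,
      (chainLength d (X n ∩ Set.Icc 0 x) : ℝ) - chainLength d (X n ∩ Set.Icc 0 y) ≤
        d * (c * ((sSup (upperEnv d f '' Set.Icc (0 : Fin d → ℝ) fun _ => M) + 2 * η) *
          ((M + 2 * η) ^ (d - 1) * (euclNorm d (x - y) + 2 * η))) ^ (1 / d : ℝ) + η) *
            (n : ℝ) ^ (1 / d : ℝ) := by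
  classical
  have hM : 0 ≤ M := (hx ⟨0, hd⟩).trans (hxM _)
  set S := sSup (upperEnv d f '' Set.Icc (0 : Fin d → ℝ) fun _ => M)
  have hS : 0 ≤ S := Real.sSup_nonneg (by rintro _ ⟨z, -, rfl⟩; exact hf.upperEnv_nonneg z)
  set D := euclNorm d (x - y)
  have hD : 0 ≤ D := Real.sqrt_nonneg _
  set T := c * ((S + 2 * η) * ((M + 2 * η) ^ (d - 1) * (D + 2 * η))) ^ (1 / d : ℝ) + η
  have hT : 0 ≤ T := by positivity
  obtain ⟨δ, hδ, hδη, hfδ⟩ := hf.exists_le_sSup_upperEnv_add hM hη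
  have hslab : ∀ᶠ n : ℕ in atTop, ∀ i, y i < x i → ∀ C : Finset (Fin d → ℝ),
      ↑C ⊆ X n ∩ Set.Icc (Function.update 0 i (y i)) x →
      IsChain (· ≤ ·) (C : Set (Fin d → ℝ)) → (C.card : ℝ) ≤ T * (n : ℝ) ^ (1 / d : ℝ) := by
    simp only [eventually_all]
    intro i hi
    have ha0 : ∀ j, 0 ≤ Function.update (0 : Fin d → ℝ) i (y i) j := fun j => by
      rcases eq_or_ne j i with rfl | hj
      · simpa using hy j
      · simp [hj]
    have hab : Function.update (0 : Fin d → ℝ) i (y i) ≤ x := fun j => by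
      rcases eq_or_ne j i with rfl | hj
      · simpa using hi.le
      · simpa [hj] using hx j
    filter_upwards [h.eventually_card_le hc hab hδ hδη (add_nonneg hS hη.le) fun z hz => hfδ z
      fun j => ⟨by linarith [(hz j).1, ha0 j], by linarith [(hz j).2, hxM j]⟩] with n hn C hC hch
    refine (hn C hC hch).trans ?_
    have hprod : ∏ j, (x j - Function.update (0 : Fin d → ℝ) i (y i) j + 2 * η) ≤
        (M + 2 * η) ^ (d - 1) * (D + 2 * η) := by
      rw [← Finset.prod_erase_mul _ _ (Finset.mem_univ i)]
      refine mul_le_mul ?_ ?_ ?_ (by positivity)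
      · refine (Finset.prod_le_prod (g := fun _ => M + 2 * η) (fun j _ => by linarith [hab j])
          fun j _ => by linarith [ha0 j, hxM j]).trans (le_of_eq ?_)
        simp
      · rw [Function.update_self]
        linarith [sub_le_euclNorm x y i]
      · linarith [hab i]
    have hnn : 0 ≤ ∏ j, (x j - Function.update (0 : Fin d → ℝ) i (y i) j + 2 * η) :=
      Finset.prod_nonneg fun j _ => by linarith [hab j]
    have hSη : S + η + η = S + 2 * η := by ring
    rw [hSη]
    simp only [T]
    gcongr
  filter_upwards [hslab, h.eventually_bounded hc hf hx, h.eventually_bounded hc hf hy]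
    with n hn ⟨B, hB⟩ ⟨B', hB'⟩
  obtain ⟨C, hC, hch, hcard⟩ := exists_card_eq_chainLength hB
  have hcover : C ⊆ C.filter (· ≤ y) ∪
      Finset.univ.biUnion fun i => C.filter fun z => y i < z i := by
    intro z hz
    by_cases hzy : z ≤ y
    · exact Finset.mem_union_left _ (Finset.mem_filter.2 ⟨hz, hzy⟩)
    · obtain ⟨i, hi⟩ := not_forall.1 hzy
      exact Finset.mem_union_right _ (Finset.mem_biUnion.2
        ⟨i, Finset.mem_univ i, Finset.mem_filter.2 ⟨hz, not_le.1 hi⟩⟩)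
  have hlow : (C.filter (· ≤ y)).card ≤ chainLength d (X n ∩ Set.Icc 0 y) := by
    refine card_le_chainLength hB' (fun z hz => ?_) (hch.mono (Finset.filter_subset _ _))
    obtain ⟨h1, h2⟩ := Finset.mem_filter.1 hz
    exact ⟨(hC h1).1, (hC h1).2.1, h2⟩
  have hi : ∀ i, ((C.filter fun z => y i < z i).card : ℝ) ≤ T * (n : ℝ) ^ (1 / d : ℝ) := by
    intro i
    rcases lt_or_ge (y i) (x i) with hlt | hge
    · refine hn i hlt _ (fun z hz => ?_) (hch.mono (Finset.filter_subset _ _))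
      obtain ⟨h1, h2⟩ := Finset.mem_filter.1 hz
      refine ⟨(hC h1).1, fun j => ?_, (hC h1).2.2⟩
      rcases eq_or_ne j i with rfl | hj
      · simpa using h2.le
      · simpa [hj] using (hC h1).2.1 j
    · rw [Finset.filter_eq_empty_iff.2 fun z hz => not_lt.2 (((hC hz).2.2 i).trans hge)]
      simp only [Finset.card_empty, Nat.cast_zero]
      positivity
  have hcount : C.card ≤ chainLength d (X n ∩ Set.Icc 0 y) +
      ∑ i, (C.filter fun z => y i < z i).card :=
    (Finset.card_le_card hcover).trans ((Finset.card_union_le _ _).trans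
      (add_le_add hlow Finset.card_biUnion_le))
  have hcount' : (C.card : ℝ) ≤ chainLength d (X n ∩ Set.Icc 0 y) +
      ∑ i, ((C.filter fun z => y i < z i).card : ℝ) := by exact_mod_cast hcount
  have hsum : ∑ i, ((C.filter fun z => y i < z i).card : ℝ) ≤
      d * T * (n : ℝ) ^ (1 / d : ℝ) := by
    refine (Finset.sum_le_sum fun i _ => hi i).trans (le_of_eq ?_)
    simp [mul_assoc]
  rw [← hcard]
  linarith

lemma limsup_le_of_eventually_le_of_nonneg {u : ℕ → ℝ} {a : ℝ} (ha : 0 ≤ a)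
    (h : ∀ᶠ n in atTop, u n ≤ a) : limsup u atTop ≤ a := by
  rw [limsup_eq]
  by_cases hb : BddBelow {a | ∀ᶠ n in atTop, u n ≤ a}
  · exact csInf_le hb h
  · rw [Real.sInf_of_not_bddBelow hb]
    exact ha

theorem ChainBoundRat.limsup_le (h : ChainBoundRat d c f X) (hd : 0 < d) (hc : 0 ≤ c)
    (hf : MemB d f) {x y : Fin d → ℝ} (hx : 0 ≤ x) (hy : 0 ≤ y) :
    limsup (fun n : ℕ => (n : ℝ) ^ (-(1 : ℝ) / d) *
      ((chainLength d (X n ∩ Set.Icc 0 x) : ℝ) - (chainLength d (X n ∩ Set.Icc 0 y) : ℝ))) atTop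
      ≤ c * d * (⨆ i, max (x i) (y i)) ^ (((d : ℝ) - 1) / d) *
        (sSup (upperEnv d f ''
          Set.Icc (0 : Fin d → ℝ) fun _ => ⨆ i, max (x i) (y i))) ^ ((1 : ℝ) / d) *
        euclNorm d (x - y) ^ ((1 : ℝ) / d) := by
  set M := ⨆ i, max (x i) (y i)
  have hxM : ∀ i, x i ≤ M := fun i => (le_max_left _ _).trans
    (le_ciSup (f := fun i => max (x i) (y i)) (Set.finite_range _).bddAbove i)
  have hM : 0 ≤ M := (hx ⟨0, hd⟩).trans (hxM _)
  set S := sSup (upperEnv d f '' Set.Icc (0 : Fin d → ℝ) fun _ => M)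
  have hS : 0 ≤ S := Real.sSup_nonneg (by rintro _ ⟨z, -, rfl⟩; exact hf.upperEnv_nonneg z)
  set D := euclNorm d (x - y)
  have hD : 0 ≤ D := Real.sqrt_nonneg _
  set G : ℝ → ℝ := fun η => d * (c * ((S + 2 * η) *
    ((M + 2 * η) ^ (d - 1) * (D + 2 * η))) ^ (1 / d : ℝ) + η) with hG
  have hs : (0 : ℝ) ≤ 1 / d := by positivity
  have hcont : Continuous G := by
    refine continuous_const.mul ((continuous_const.mul (Continuous.rpow_const (by fun_prop)
      fun _ => Or.inr hs)).add continuous_id)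
  have hG0 : G 0 = c * d * M ^ (((d : ℝ) - 1) / d) * S ^ ((1 : ℝ) / d) * D ^ ((1 : ℝ) / d) := by
    have hpow : (M ^ (d - 1)) ^ (1 / d : ℝ) = M ^ (((d : ℝ) - 1) / d) := by
      rw [← Real.rpow_natCast, ← Real.rpow_mul hM, Nat.cast_pred hd]
      congr 1
      ring
    simp only [hG, mul_zero, add_zero]
    rw [Real.mul_rpow hS (by positivity), Real.mul_rpow (by positivity) hD, hpow]
    ring
  rw [← hG0]
  have hlim : Tendsto G (𝓝[>] 0) (𝓝 (G 0)) := hcont.continuousAt.tendsto.mono_left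
    nhdsWithin_le_nhds
  refine ge_of_tendsto hlim (eventually_nhdsWithin_of_forall fun η hη => ?_)
  have hη : 0 < η := hη
  refine limsup_le_of_eventually_le_of_nonneg (by positivity) ?_
  filter_upwards [h.eventually_sub_le hd hc hf hx hy hxM hη, eventually_gt_atTop 0] with n hn hn0
  have hnpos : (0 : ℝ) < n := by exact_mod_cast hn0
  rw [neg_div, Real.rpow_neg hnpos.le, inv_mul_le_iff₀ (by positivity), mul_comm]
  exact hn

end Deterministic

/-- Stability: With probability one, simultaneously for all `x, y ∈ [0,∞)^d`,
`limsup_n n^{-1/d} (U_n(x) - U_n(y)) ≤ c_d d M^{(d-1)/d} (sup_{[0,M]^d} f*)^{1/d} |x-y|^{1/d}`. -/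
theorem longest_chain_holder_estimate_uniform
    {d : ℕ} (hd : 0 < d) (c : ℝ) (hc : IsBWConstant d c)
    (f : (Fin d → ℝ) → ℝ) (hf : MemB d f)
    {Ω : Type*} [MeasurableSpace Ω] (P : Measure Ω) [IsProbabilityMeasure P]
    (PP : ∀ n : ℕ, PoissonPP d P fun z => (n : ℝ) * f z) :
    P {ω | ∀ x y : Fin d → ℝ, 0 ≤ x → 0 ≤ y →
      limsup (fun n : ℕ =>
        (n : ℝ) ^ (-(1 : ℝ) / d) *
          ((chainLength d ((PP n).pts ω ∩ Set.Icc 0 x) : ℝ) -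
            (chainLength d ((PP n).pts ω ∩ Set.Icc 0 y) : ℝ))) atTop
      ≤ c * d * (⨆ i, max (x i) (y i)) ^ (((d : ℝ) - 1) / d) *
        (sSup (upperEnv d f ''
          Set.Icc (0 : Fin d → ℝ) fun _ => ⨆ i, max (x i) (y i))) ^ ((1 : ℝ) / d) *
        euclNorm d (x - y) ^ ((1 : ℝ) / d)} = 1 := by
  have hae : ∀ᵐ ω ∂P, ChainBoundRat d c f fun n => (PP n).pts ω := by
    simp only [ChainBoundRat, ae_all_iff]
    intro a b L ε hab hL hε hle
    exact ae_eventually_chain_card_le hd hc hf.2.1 PP hab hL hle hε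
  rw [← measure_univ (μ := P)]
  refine measure_congr (eventuallyEq_univ.2 ?_)
  filter_upwards [hae] with ω hω x y hx hy
  exact hω.limsup_le hd hc.1.le hf hx hy

end
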